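/- There exist constants D > 1, κ > 0 and K > 0 such that for every τ ∈ (0,1) and all integers L, M₁, M₂, R ≥ 0 and q ≥ 2 (setting N₁ = L + M₁ + R and N₂ = L + M₂ + R): (i) the set PowerPairs(τ, L, M₁, M₂, R; q) is empty unless D⁻¹·log(1/τ) − κ ≤ N₁ ≤ D·log(1/τ) + κ, D⁻¹·log(1/τ) − κ ≤ N₂ ≤ D·log(1/τ) + κ, and q ≤ D·log(1/τ) + κ; and (ii) whenever D⁻¹·log(1/τ) − κ ≤ N₁, N₂ ≤ D·log(1/τ) + κ, one has #PowerPairs(τ, L, M₁, M₂, R; q) ≤ K·τ^{−δ}, where δ is the Hausdorff dimension of the limit set Λ. -/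

import Mathlib

open MeasureTheory

/-- `SL(2,ℝ)`. -/
abbrev SL2 : Type := Matrix.SpecialLinearGroup (Fin 2) ℝ

/-- The Möbius transformation of `g ∈ SL(2,ℝ)` acting on `ℂ` (junk at the pole). -/
noncomputable def mobiusC (g : SL2) (z : ℂ) : ℂ :=
  ((g.1 0 0 : ℂ) * z + (g.1 0 1 : ℂ)) / ((g.1 1 0 : ℂ) * z + (g.1 1 1 : ℂ))

/-- The Möbius transformation of `g ∈ SL(2,ℝ)` acting on `ℝ` (junk at the pole). -/
noncomputable def mobiusR (g : SL2) (x : ℝ) : ℝ :=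
  (g.1 0 0 * x + g.1 0 1) / (g.1 1 0 * x + g.1 1 1)

/-- The derivative `γ'(z) = (uz+v)⁻²` of the Möbius transformation of `g`. -/
noncomputable def mobiusDerivC (g : SL2) (z : ℂ) : ℂ :=
  ((g.1 1 0 : ℂ) * z + (g.1 1 1 : ℂ))⁻¹ ^ 2

/-- The derivative `γ'(x) = (ux+v)⁻²` of the Möbius transformation of `g`, real version. -/
noncomputable def mobiusDerivR (g : SL2) (x : ℝ) : ℝ :=
  (g.1 1 0 * x + g.1 1 1)⁻¹ ^ 2

/-- The Möbius transformation of `g ∈ SL(2,ℝ)` acting on the Riemann sphere `ℂ ∪ {∞}`. -/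
noncomputable def mobiusS (g : SL2) (z : OnePoint ℂ) : OnePoint ℂ :=
  Option.elim z
    (if (g.1 1 0 : ℝ) = 0 then OnePoint.infty else (((g.1 0 0 / g.1 1 0 : ℝ) : ℂ) : OnePoint ℂ))
    (fun w => if ((g.1 1 0 : ℂ) * w + (g.1 1 1 : ℂ)) = 0 then OnePoint.infty
      else ((mobiusC g w : ℂ) : OnePoint ℂ))

/-- The involution `a ↦ ā = a + r mod 2r` on the alphabet `𝒜 = Fin (2r)`. -/
def wordBar {r : ℕ} (a : Fin (2 * r)) : Fin (2 * r) :=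
  ⟨(a.1 + r) % (2 * r), Nat.mod_lt _ (Nat.lt_of_le_of_lt (Nat.zero_le _) a.isLt)⟩

/-- A word: a finite sequence of letters with no adjacent letter equal to the bar of the
previous one. -/
def IsWord {r : ℕ} (w : List (Fin (2 * r))) : Prop :=
  w.Chain' (fun x y => x ≠ wordBar y)

/-- The mirror word `𝐚̄ = (ā_n, …, ā_1)`. -/
def mirror {r : ℕ} (w : List (Fin (2 * r))) : List (Fin (2 * r)) :=
  (w.map wordBar).reverse

/-- `𝐚 → 𝐛` : either word is empty, or the last letter of `𝐚` is not the bar of the first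
letter of `𝐛`. -/
def arrow {r : ℕ} (w v : List (Fin (2 * r))) : Prop :=
  ∀ x ∈ w.getLast?, ∀ y ∈ v.head?, x ≠ wordBar y

/-- `𝐚 ⇝ 𝐛` : both words are nonempty and the last letter of `𝐚` equals the first letter
of `𝐛`. -/
def wiggly {r : ℕ} (w v : List (Fin (2 * r))) : Prop :=
  w ≠ [] ∧ v ≠ [] ∧ w.getLast? = v.head?

/-- Schottky data: pairwise disjoint closed discs centered on the real line, paired by
elements of `SL(2,ℝ)`. -/
structure Schottky where
  r : ℕ
  two_le_r : 2 ≤ r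
  center : Fin (2 * r) → ℝ
  radius : Fin (2 * r) → ℝ
  radius_pos : ∀ a, 0 < radius a
  g : Fin (2 * r) → SL2
  disjoint : ∀ a b : Fin (2 * r), a ≠ b →
    Disjoint (closure (Metric.ball ((center a : ℂ)) (radius a)))
             (closure (Metric.ball ((center b : ℂ)) (radius b)))
  g_bar : ∀ a : Fin (2 * r), g (wordBar a) = (g a)⁻¹
  maps : ∀ a : Fin (2 * r),
    mobiusS (g a) '' (((fun w : ℂ => (w : OnePoint ℂ)) ''
        Metric.ball ((center (wordBar a) : ℂ)) (radius (wordBar a)))ᶜ)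
      = (fun w : ℂ => (w : OnePoint ℂ)) '' closure (Metric.ball ((center a : ℂ)) (radius a))

namespace Schottky

variable (S : Schottky)

/-- The open disc `D_a`. -/
def D (a : Fin (2 * S.r)) : Set ℂ := Metric.ball ((S.center a : ℂ)) (S.radius a)

/-- The union `𝐃` of the open discs. -/
def Dall : Set ℂ := ⋃ a, S.D a

/-- The open interval `I_a = D_a ∩ ℝ`. -/
def Ireal (a : Fin (2 * S.r)) : Set ℝ := {x : ℝ | (x : ℂ) ∈ S.D a}

/-- The union `I` of the intervals `I_a`. -/
def Iall : Set ℝ := ⋃ a, S.Ireal a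

/-- The group element `γ_𝐚 = γ_{a₁} ⋯ γ_{a_n}` associated to a word. -/
noncomputable def wprod (w : List (Fin (2 * S.r))) : SL2 := (w.map S.g).prod

/-- The Schottky group `Γ`, generated by the `γ_a`. -/
def SGroup : Subgroup SL2 := Subgroup.closure (Set.range S.g)

theorem wprod_mem (w : List (Fin (2 * S.r))) : S.wprod w ∈ S.SGroup := by
  apply Subgroup.list_prod_mem
  intro x hx
  obtain ⟨a, -, rfl⟩ := List.mem_map.mp hx
  exact Subgroup.subset_closure ⟨a, rfl⟩

/-- `γ_𝐚` as an element of the Schottky group `Γ`. -/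
noncomputable def wprodG (w : List (Fin (2 * S.r))) : S.SGroup := ⟨S.wprod w, S.wprod_mem w⟩

/-- The generator `γ_a` as an element of `Γ`. -/
noncomputable def genG (a : Fin (2 * S.r)) : S.SGroup :=
  ⟨S.g a, Subgroup.subset_closure ⟨a, rfl⟩⟩

/-- The interval `I_𝐚 = γ_{𝐚'}(I_{a_n})` of a nonempty word. -/
noncomputable def Iset (w : List (Fin (2 * S.r))) : Set ℝ :=
  if h : w = [] then ∅ else mobiusR (S.wprod w.dropLast) '' S.Ireal (w.getLast h)

/-- `Υ_𝐚 = |I_𝐚|`, the length of the interval `I_𝐚`; `Υ_∅ = 1`. -/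
noncomputable def ups (w : List (Fin (2 * S.r))) : ℝ :=
  if w = [] then 1 else (volume (S.Iset w)).toReal

/-- The Bourgain–Dyatlov partition `Z(τ)`. -/
def Zset (τ : ℝ) : Set (List (Fin (2 * S.r))) :=
  {w | IsWord w ∧ w ≠ [] ∧ S.ups w ≤ τ ∧ τ < S.ups w.dropLast}

/-- The mirror set `Z̄(τ) = {𝐚 ∈ 𝒲 : 𝐚̄ ∈ Z(τ)}`. -/
def Zbar (τ : ℝ) : Set (List (Fin (2 * S.r))) :=
  {w | IsWord w ∧ mirror w ∈ S.Zset τ}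

open Classical in
/-- The Bowen–Series map on the Riemann sphere (junk value `∞` off `𝐃`). -/
noncomputable def TS (z : OnePoint ℂ) : OnePoint ℂ :=
  if h : ∃ a : Fin (2 * S.r), ∃ w : ℂ, z = (w : OnePoint ℂ) ∧ w ∈ S.D a
  then mobiusS (S.g h.choose)⁻¹ z
  else OnePoint.infty

/-- The limit set `Λ`: points of `𝐃` all of whose forward iterates under the Bowen–Series
map are defined (finite) and remain in `𝐃`. -/
def limitSet : Set ℂ :=
  {z : ℂ | ∀ n : ℕ, ∃ w : ℂ, (S.TS)^[n] (z : OnePoint ℂ) = (w : OnePoint ℂ) ∧ w ∈ S.Dall}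

/-- The limit set, viewed inside `ℝ`. -/
def limitSetR : Set ℝ := {x : ℝ | (x : ℂ) ∈ S.limitSet}

/-- `δ`, the Hausdorff dimension of the limit set. -/
noncomputable def delta : ℝ := (dimH S.limitSet).toReal

/-- `PowerPairs(τ)`: pairs `(𝐚,𝐛) ∈ Z̄(τ)²` such that `γ_{𝐚'}γ_{𝐛'}⁻¹` is a nontrivial
proper power in `Γ`. -/
def PowerPairs (τ : ℝ) : Set (List (Fin (2 * S.r)) × List (Fin (2 * S.r))) :=
  {p | p.1 ∈ S.Zbar τ ∧ p.2 ∈ S.Zbar τ ∧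
    S.wprod p.1.dropLast * (S.wprod p.2.dropLast)⁻¹ ≠ 1 ∧
    ∃ γ₀ ∈ S.SGroup, ∃ q : ℕ, 2 ≤ q ∧
      S.wprod p.1.dropLast * (S.wprod p.2.dropLast)⁻¹ = (γ₀ : SL2) ^ q}

end Schottky

namespace Schottky

/-- `PowerPairs(τ; q)`: pairs `(𝐚,𝐛) ∈ Z̄(τ)²` such that `γ_{𝐚'}γ_{𝐛'}⁻¹` is a `q`-th power
in `Γ`, with `q` maximal. -/
def PowerPairsQ (S : Schottky) (τ : ℝ) (q : ℕ) :
    Set (List (Fin (2 * S.r)) × List (Fin (2 * S.r))) :=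
  {p | p.1 ∈ S.Zbar τ ∧ p.2 ∈ S.Zbar τ ∧
    (∃ γ₀ ∈ S.SGroup, S.wprod p.1.dropLast * (S.wprod p.2.dropLast)⁻¹ = γ₀ ^ q) ∧
    (∀ q' : ℕ, q < q' →
      ¬ ∃ γ₁ ∈ S.SGroup, S.wprod p.1.dropLast * (S.wprod p.2.dropLast)⁻¹ = γ₁ ^ q')}

/-- `PowerPairs(τ, L, M₁, M₂, R; q)`: elements of `PowerPairs(τ; q)` whose words
`𝐚'`, `𝐛'` have lengths `N₁ = L + M₁ + R` and `N₂ = L + M₂ + R`, agree exactly on the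
common prefix of length `L` and the common suffix of length `R`. -/
def PowerPairsPart (S : Schottky) (τ : ℝ) (L M₁ M₂ R q : ℕ) :
    Set (List (Fin (2 * S.r)) × List (Fin (2 * S.r))) :=
  {p | p ∈ S.PowerPairsQ τ q ∧
    p.1.dropLast.length = L + M₁ + R ∧
    p.2.dropLast.length = L + M₂ + R ∧
    p.1.dropLast.take L = p.2.dropLast.take L ∧
    ¬ (∃ x, p.1.dropLast[L]? = some x ∧ p.2.dropLast[L]? = some x) ∧
    p.1.dropLast.reverse.take R = p.2.dropLast.reverse.take R ∧
    ¬ (∃ x, p.1.dropLast.reverse[R]? = some x ∧ p.2.dropLast.reverse[R]? = some x)}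

end Schottky

/-- If a coding of the points of a set by `m`-ary sequences separates two sequences that first
differ at position `k` by at least `c t ^ k`, then the set has dimension at least
`log m / log (1 / t)`. -/
theorem le_dimH_range_of_coding {X : Type*} [MetricSpace X] {m : ℕ} (hm : 1 < m) {t c : ℝ}
    (ht : 0 < t) (ht1 : t < 1) (hc : 0 < c) (g : (ℕ → Fin m) → X)
    (hg : ∀ (d e : ℕ → Fin m) (k : ℕ), (∀ i < k, d i = e i) → d k ≠ e k →
      c * t ^ k ≤ dist (g d) (g e)) :
    ENNReal.ofReal (Real.log m / Real.log t⁻¹) ≤ dimH (Set.range g) := by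
  have hm0 : (0 : ℝ) < m := by exact_mod_cast (by omega : 0 < m)
  have : NeZero m := ⟨by omega⟩
  set s : ℝ := Real.log m / Real.log t⁻¹ with hs
  have hlt : 0 < Real.log t⁻¹ := Real.log_pos ((one_lt_inv₀ ht).2 ht1)
  have hs0 : 0 < s := div_pos (Real.log_pos (by exact_mod_cast hm)) hlt
  have hts : t ^ s = (m : ℝ)⁻¹ := by
    rw [Real.rpow_def_of_pos ht, ← Real.exp_log (inv_pos.2 hm0)]
    congr 1
    rw [Real.log_inv] at hs ⊢
    have : Real.log t ≠ 0 := by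
      rw [Real.log_inv] at hlt
      linarith
    rw [hs]
    field_simp
  have hfirst : ∀ d e : ℕ → Fin m, d ≠ e → ∃ k, (∀ i < k, d i = e i) ∧ d k ≠ e k := by
    intro d e hne
    have hex : ∃ k, d k ≠ e k := Function.ne_iff.1 hne
    classical
    exact ⟨Nat.find hex, fun i hi => not_not.1 (Nat.find_min hex hi), Nat.find_spec hex⟩
  have hginj : Function.Injective g := by
    intro d e h
    by_contra hne
    obtain ⟨k, hk, hk'⟩ := hfirst d e hne
    have := hg d e k hk hk'
    rw [h, dist_self] at this
    have : 0 < c * t ^ k := by positivity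
    linarith
  set f : X → ℝ := fun x => Real.ofDigits (Function.invFun g x) with hf
  have hfg : ∀ d, f (g d) = Real.ofDigits d := fun d => by
    rw [hf]
    simp only [Function.leftInverse_invFun hginj d]
  have hH : HolderOnWith (Real.toNNReal (c⁻¹ ^ s)) (Real.toNNReal s) f (Set.range g) := by
    rintro _ ⟨d, rfl⟩ _ ⟨e, rfl⟩
    rw [hfg, hfg]
    by_cases hne : d = e
    · simp [hne]
    obtain ⟨k, hk, hk'⟩ := hfirst d e hne
    have h1 := hg d e k hk hk'
    have h2 : |Real.ofDigits d - Real.ofDigits e| ≤ ((m : ℝ) ^ k)⁻¹ :=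
      Real.abs_ofDigits_sub_ofDigits_le hk
    have h3 : ((m : ℝ) ^ k)⁻¹ ≤ c⁻¹ ^ s * dist (g d) (g e) ^ s := by
      rw [← Real.mul_rpow (by positivity) dist_nonneg, ← inv_pow, ← hts, ← Real.rpow_natCast,
        ← Real.rpow_mul ht.le, mul_comm s, Real.rpow_mul ht.le, Real.rpow_natCast]
      apply Real.rpow_le_rpow (by positivity) _ hs0.le
      rw [inv_mul_eq_div, le_div_iff₀ hc]
      linarith
    rw [edist_dist, edist_dist, Real.dist_eq, Real.coe_toNNReal _ hs0.le,
      ENNReal.ofReal_rpow_of_nonneg dist_nonneg hs0.le,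
      show ((Real.toNNReal (c⁻¹ ^ s) : NNReal) : ENNReal) = ENNReal.ofReal (c⁻¹ ^ s) from rfl,
      ← ENNReal.ofReal_mul (by positivity)]
    exact ENNReal.ofReal_le_ofReal (h2.trans h3)
  have hdim := hH.dimH_image_le (Real.toNNReal_pos.2 hs0)
  have hsub : Set.Icc (0 : ℝ) 1 ⊆ f '' Set.range g := by
    intro x hx
    obtain ⟨d, -, hd⟩ := Real.ofDigits_SurjOn hm hx
    exact ⟨g d, ⟨d, rfl⟩, by rw [hfg, hd]⟩
  have hone : dimH (Set.Icc (0 : ℝ) 1) = 1 :=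
    (Real.dimH_of_nonempty_interior (by rw [interior_Icc]; exact Set.nonempty_Ioo.2 one_pos)).trans
      (by simp)
  have h1 : (1 : ENNReal) ≤ dimH (Set.range g) / (Real.toNNReal s : NNReal) :=
    hone ▸ (dimH_mono hsub).trans hdim
  rw [ENNReal.le_div_iff_mul_le (Or.inl (by simpa using hs0)) (Or.inl (by simp)), one_mul] at h1
  exact h1

/-- A lower bound for the dimension of the attractor of an iterated function system whose
compositions of length `k` contract by at most `c t ^ k`. -/
theorem le_dimH_of_ifs {m : ℕ} (hm : 1 < m) {t c : ℝ} (ht : 0 < t) (ht1 : t < 1) (hc : 0 < c)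
    {J : Set ℝ} (hJ : IsCompact J) (hJne : J.Nonempty) (φ : Fin m → ℝ → ℝ)
    (hmaps : ∀ i, Set.MapsTo (φ i) J J) (hcont : ∀ i, ContinuousOn (φ i) J)
    (hdisj : ∀ i j, i ≠ j → Disjoint (φ i '' J) (φ j '' J))
    (hexp : ∀ (w : List (Fin m)), ∀ x ∈ J, ∀ y ∈ J, c * t ^ w.length * |x - y| ≤
      |w.foldr (fun i => φ i) x - w.foldr (fun i => φ i) y|)
    {E : Set ℝ} (hE : ∀ x, (∀ k, ∃ w : List (Fin m), w.length = k ∧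
      x ∈ (fun y => w.foldr (fun i => φ i) y) '' J) → x ∈ E) :
    ENNReal.ofReal (Real.log m / Real.log t⁻¹) ≤ dimH E := by
  have hfold : ∀ w : List (Fin m), Set.MapsTo (fun y => w.foldr (fun i => φ i) y) J J := by
    intro w
    induction w with
    | nil => exact fun x hx => hx
    | cons i w ih => exact fun x hx => hmaps i (ih hx)
  have hfoldc : ∀ w : List (Fin m), ContinuousOn (fun y => w.foldr (fun i => φ i) y) J := by
    intro w
    induction w with
    | nil => exact continuousOn_id
    | cons i w ih => exact (hcont i).comp ih (hfold w)
  obtain ⟨η, hη, hgap⟩ : ∃ η > 0, ∀ i j, i ≠ j → ∀ x ∈ J, ∀ y ∈ J, η ≤ |φ i x - φ j y| := by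
    have hpair : ∀ p : Fin m × Fin m, ∃ η > 0, p.1 ≠ p.2 → ∀ x ∈ J, ∀ y ∈ J,
        η ≤ |φ p.1 x - φ p.2 y| := by
      rintro ⟨i, j⟩
      by_cases hij : i = j
      · exact ⟨1, one_pos, fun h => absurd hij h⟩
      · obtain ⟨δ, hδ, h⟩ := Metric.exists_pos_forall_lt_edist (hJ.image_of_continuousOn (hcont i))
          (hJ.image_of_continuousOn (hcont j)).isClosed (hdisj i j hij)
        refine ⟨δ, hδ, fun _ x hx y hy => ?_⟩
        have := h _ (Set.mem_image_of_mem _ hx) _ (Set.mem_image_of_mem _ hy)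
        rw [edist_nndist, ENNReal.coe_lt_coe] at this
        have h' : (δ : ℝ) < dist (φ i x) (φ j y) := by exact_mod_cast this
        rw [Real.dist_eq] at h'
        exact h'.le
    choose η hη h using hpair
    have : Nonempty (Fin m × Fin m) := ⟨(⟨0, by omega⟩, ⟨0, by omega⟩)⟩
    obtain ⟨p₀, hp₀⟩ := Finite.exists_min η
    exact ⟨η p₀, hη p₀, fun i j hij x hx y hy => (hp₀ (i, j)).trans (h (i, j) hij x hx y hy)⟩
  have hpoint : ∀ d : ℕ → Fin m, ∃ x : ℝ, ∀ k,
      x ∈ (fun y => ((List.range k).map d).foldr (fun i => φ i) y) '' J := by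
    intro d
    have hne := IsCompact.nonempty_iInter_of_sequence_nonempty_isCompact_isClosed
      (fun k => (fun y => ((List.range k).map d).foldr (fun i => φ i) y) '' J)
      (fun k => by
        rintro _ ⟨y, hy, rfl⟩
        refine ⟨φ (d k) y, hmaps _ hy, ?_⟩
        simp [List.range_succ])
      (fun k => hJne.image _) (hJ.image_of_continuousOn (hfoldc _))
      (fun k => (hJ.image_of_continuousOn (hfoldc _)).isClosed)
    obtain ⟨x, hx⟩ := hne
    exact ⟨x, fun k => Set.mem_iInter.1 hx k⟩
  choose g hg using hpoint
  refine (le_dimH_range_of_coding hm ht ht1 (mul_pos hc hη) g ?_).trans (dimH_mono ?_)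
  · intro d e k hk hk'
    obtain ⟨x, hx, hxd⟩ := hg d (k + 1)
    obtain ⟨y, hy, hye⟩ := hg e (k + 1)
    have hmap : (List.range k).map d = (List.range k).map e :=
      List.map_congr_left fun i hi => hk i (List.mem_range.1 hi)
    simp only [List.range_succ, List.map_append, List.map_cons, List.map_nil, List.foldr_append,
      List.foldr_cons, List.foldr_nil] at hxd hye
    have h1 := hexp ((List.range k).map e) _ (hmaps (d k) hx) _ (hmaps (e k) hy)
    rw [Real.dist_eq, ← hxd, ← hye, hmap]
    refine le_trans ?_ h1
    rw [List.length_map, List.length_range, mul_right_comm]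
    exact mul_le_mul_of_nonneg_left (hgap _ _ hk' x hx y hy) (by positivity)
  · rintro _ ⟨d, rfl⟩
    exact hE _ fun k => ⟨_, by simp, hg d k⟩

section Words

variable {r : ℕ}

theorem wordBar_wordBar (a : Fin (2 * r)) : wordBar (wordBar a) = a := by
  have ha := a.isLt
  apply Fin.ext
  simp only [wordBar]
  rcases lt_or_ge (a.1 + r) (2 * r) with h | h
  · rw [Nat.mod_eq_of_lt h, show a.1 + r + r = a.1 + 2 * r by ring, Nat.add_mod_right,
      Nat.mod_eq_of_lt ha]
  · rw [Nat.mod_eq_sub_mod h, Nat.mod_eq_of_lt (show a.1 + r - 2 * r < 2 * r by omega),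
      show a.1 + r - 2 * r + r = a.1 by omega, Nat.mod_eq_of_lt ha]

theorem wordBar_eq_comm {a b : Fin (2 * r)} : wordBar a = b ↔ a = wordBar b :=
  ⟨fun h => by rw [← h, wordBar_wordBar], fun h => by rw [h, wordBar_wordBar]⟩

theorem isWord_nil : IsWord ([] : List (Fin (2 * r))) := List.isChain_nil

theorem isWord_singleton (a : Fin (2 * r)) : IsWord [a] := List.isChain_singleton a

theorem isWord_append {w v : List (Fin (2 * r))} :
    IsWord (w ++ v) ↔ IsWord w ∧ IsWord v ∧ arrow w v := List.isChain_append

theorem isWord_cons {a : Fin (2 * r)} {v : List (Fin (2 * r))} :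
    IsWord (a :: v) ↔ (∀ y ∈ v.head?, a ≠ wordBar y) ∧ IsWord v := List.isChain_cons

theorem arrow_singleton_right {w : List (Fin (2 * r))} {b : Fin (2 * r)} :
    arrow w [b] ↔ ∀ x ∈ w.getLast?, x ≠ wordBar b := by
  simp [arrow]

theorem arrow_concat_left {w v : List (Fin (2 * r))} {b : Fin (2 * r)} :
    arrow (w ++ [b]) v ↔ ∀ y ∈ v.head?, b ≠ wordBar y := by
  simp [arrow]

theorem mirror_nil : mirror ([] : List (Fin (2 * r))) = [] := rfl

theorem mirror_append (w v : List (Fin (2 * r))) : mirror (w ++ v) = mirror v ++ mirror w := by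
  simp [mirror]

theorem mirror_singleton (a : Fin (2 * r)) : mirror [a] = [wordBar a] := rfl

theorem mirror_mirror (w : List (Fin (2 * r))) : mirror (mirror w) = w := by
  simp [mirror, wordBar_wordBar, Function.comp_def]

theorem length_mirror (w : List (Fin (2 * r))) : (mirror w).length = w.length := by
  simp [mirror]

theorem mirror_injective : Function.Injective (mirror (r := r)) :=
  Function.LeftInverse.injective mirror_mirror

theorem isWord_mirror {w : List (Fin (2 * r))} (h : IsWord w) : IsWord (mirror w) := by
  refine List.isChain_reverse.2 ((List.isChain_map wordBar).2 (List.IsChain.imp ?_ h))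
  intro a b hab h'
  rw [wordBar_wordBar] at h'
  exact hab h'.symm

theorem head?_mirror (w : List (Fin (2 * r))) : (mirror w).head? = w.getLast?.map wordBar := by
  simp [mirror]

theorem getLast?_mirror (w : List (Fin (2 * r))) : (mirror w).getLast? = w.head?.map wordBar := by
  simp [mirror]

end Words

section Mobius

theorem SL2.det_eq (g : SL2) : g.1 0 0 * g.1 1 1 - g.1 0 1 * g.1 1 0 = 1 := by
  rw [← Matrix.det_fin_two]
  exact g.2

theorem SL2.inv_eq (g : SL2) : (g⁻¹).1 0 0 = g.1 1 1 ∧ (g⁻¹).1 0 1 = -g.1 0 1 ∧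
    (g⁻¹).1 1 0 = -g.1 1 0 ∧ (g⁻¹).1 1 1 = g.1 0 0 := by
  have : (g⁻¹).1 = g.1.adjugate := Matrix.SpecialLinearGroup.coe_inv g
  rw [this, Matrix.adjugate_fin_two]
  simp

theorem SL2.mul_eq (g h : SL2) (i j : Fin 2) :
    (g * h).1 i j = g.1 i 0 * h.1 0 j + g.1 i 1 * h.1 1 j := by
  rw [Matrix.SpecialLinearGroup.coe_mul, Matrix.mul_apply, Fin.sum_univ_two]

/-- The denominator of the Möbius transformation of `g`. -/
noncomputable def mobiusDen (g : SL2) (x : ℝ) : ℝ := g.1 1 0 * x + g.1 1 1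

theorem mobiusR_def (g : SL2) (x : ℝ) : mobiusR g x = (g.1 0 0 * x + g.1 0 1) / mobiusDen g x := rfl

theorem mobiusDen_mul (g h : SL2) {x : ℝ} (hx : mobiusDen h x ≠ 0) :
    mobiusDen (g * h) x = mobiusDen g (mobiusR h x) * mobiusDen h x := by
  rw [mobiusR_def, mobiusDen, mobiusDen, add_mul, mul_assoc, div_mul_cancel₀ _ hx, mobiusDen,
    SL2.mul_eq, SL2.mul_eq]
  ring

theorem mobiusR_mul (g h : SL2) {x : ℝ} (hx : mobiusDen h x ≠ 0) :
    mobiusR (g * h) x = mobiusR g (mobiusR h x) := by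
  rw [mobiusR_def (g * h), mobiusDen_mul g h hx, mobiusR_def g, mul_comm (mobiusDen g _),
    ← div_div]
  congr 1
  rw [mobiusR_def, SL2.mul_eq, SL2.mul_eq]
  field_simp
  rw [mobiusDen]
  ring

theorem mobiusR_one (x : ℝ) : mobiusR 1 x = x := by simp [mobiusR]

theorem mobiusDen_one (x : ℝ) : mobiusDen 1 x = 1 := by simp [mobiusDen]

theorem mobiusR_inv_mobiusR (g : SL2) {x : ℝ} (hx : mobiusDen g x ≠ 0) :
    mobiusR g⁻¹ (mobiusR g x) = x := by
  rw [← mobiusR_mul _ _ hx, inv_mul_cancel, mobiusR_one]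

theorem mobiusDen_inv_mobiusR (g : SL2) {x : ℝ} (hx : mobiusDen g x ≠ 0) :
    mobiusDen g⁻¹ (mobiusR g x) ≠ 0 := by
  intro h
  have := mobiusDen_mul g⁻¹ g hx
  rw [h, zero_mul, inv_mul_cancel, mobiusDen_one] at this
  exact one_ne_zero this

theorem mobiusR_sub (g : SL2) {x y : ℝ} (hx : mobiusDen g x ≠ 0) (hy : mobiusDen g y ≠ 0) :
    mobiusR g y - mobiusR g x = (y - x) / (mobiusDen g x * mobiusDen g y) := by
  rw [mobiusR_def, mobiusR_def, div_sub_div _ _ hy hx, mul_comm (mobiusDen g x)]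
  congr 1
  rw [mobiusDen, mobiusDen]
  linear_combination (y - x) * SL2.det_eq g

theorem mobiusR_injOn (g : SL2) {x y : ℝ} (hx : mobiusDen g x ≠ 0) (hy : mobiusDen g y ≠ 0)
    (h : mobiusR g x = mobiusR g y) : x = y := by
  rw [← mobiusR_inv_mobiusR g hx, h, mobiusR_inv_mobiusR g hy]

theorem mobiusS_ofReal (g : SL2) {x : ℝ} (hx : mobiusDen g x ≠ 0) :
    mobiusS g (((x : ℂ)) : OnePoint ℂ) = ((mobiusR g x : ℂ) : OnePoint ℂ) := by
  have : (g.1 1 0 : ℂ) * (x : ℂ) + (g.1 1 1 : ℂ) ≠ 0 := by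
    have h : ((mobiusDen g x : ℝ) : ℂ) ≠ 0 := by exact_mod_cast hx
    simpa [mobiusDen] using h
  change (if ((g.1 1 0 : ℂ) * x + (g.1 1 1 : ℂ)) = 0 then OnePoint.infty
      else ((mobiusC g x : ℂ) : OnePoint ℂ)) = _
  rw [if_neg this]
  congr 1
  rw [mobiusC, mobiusR]
  push_cast
  rfl

theorem mobiusS_ofReal_eq_infty (g : SL2) {x : ℝ} (hx : mobiusDen g x = 0) :
    mobiusS g (((x : ℂ)) : OnePoint ℂ) = OnePoint.infty := by
  have : (g.1 1 0 : ℂ) * (x : ℂ) + (g.1 1 1 : ℂ) = 0 := by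
    have h : ((mobiusDen g x : ℝ) : ℂ) = 0 := by exact_mod_cast hx
    simpa [mobiusDen] using h
  exact if_pos this

theorem mobiusS_infty (g : SL2) : mobiusS g OnePoint.infty =
    if g.1 1 0 = 0 then OnePoint.infty else (((g.1 0 0 / g.1 1 0 : ℝ) : ℂ) : OnePoint ℂ) := rfl

end Mobius

namespace Schottky

variable (S : Schottky)

/-- The closure of the interval `I_a`. -/
def Jreal (a : Fin (2 * S.r)) : Set ℝ :=
  Set.Icc (S.center a - S.radius a) (S.center a + S.radius a)

theorem Ireal_eq (a : Fin (2 * S.r)) :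
    S.Ireal a = Set.Ioo (S.center a - S.radius a) (S.center a + S.radius a) := by
  ext x
  simp only [Ireal, D, Set.mem_ofPred_eq, Metric.mem_ball, Complex.dist_eq, Set.mem_Ioo]
  rw [← Complex.ofReal_sub, Complex.norm_real, Real.norm_eq_abs, abs_lt]
  constructor <;> rintro ⟨h1, h2⟩ <;> constructor <;> linarith

theorem mem_Ireal_iff {a : Fin (2 * S.r)} {x : ℝ} : x ∈ S.Ireal a ↔ (x : ℂ) ∈ S.D a := Iff.rfl

theorem mem_Jreal_iff {a : Fin (2 * S.r)} {x : ℝ} :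
    x ∈ S.Jreal a ↔ (x : ℂ) ∈ closure (Metric.ball (S.center a : ℂ) (S.radius a)) := by
  rw [closure_ball _ (S.radius_pos a).ne']
  simp only [Jreal, Metric.mem_closedBall, Complex.dist_eq, Set.mem_Icc]
  rw [← Complex.ofReal_sub, Complex.norm_real, Real.norm_eq_abs, abs_le]
  constructor <;> rintro ⟨h1, h2⟩ <;> constructor <;> linarith

theorem Ireal_subset_Jreal (a : Fin (2 * S.r)) : S.Ireal a ⊆ S.Jreal a := by
  rw [Ireal_eq]
  exact Set.Ioo_subset_Icc_self

theorem disjoint_Jreal {a b : Fin (2 * S.r)} (h : a ≠ b) : Disjoint (S.Jreal a) (S.Jreal b) :=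
  Set.disjoint_left.2 fun _ ha hb => Set.disjoint_left.1 (S.disjoint a b h)
    (S.mem_Jreal_iff.1 ha) (S.mem_Jreal_iff.1 hb)

theorem eq_of_mem_Jreal {a b : Fin (2 * S.r)} {x : ℝ} (ha : x ∈ S.Jreal a) (hb : x ∈ S.Jreal b) :
    a = b := by
  by_contra h
  exact Set.disjoint_left.1 (S.disjoint_Jreal h) ha hb

theorem g_exterior (a : Fin (2 * S.r)) {x : ℝ} (hx : x ∉ S.Ireal (wordBar a)) :
    mobiusDen (S.g a) x ≠ 0 ∧ mobiusR (S.g a) x ∈ S.Jreal a := by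
  have hmem : mobiusS (S.g a) ((x : ℂ) : OnePoint ℂ) ∈
      (fun w : ℂ => (w : OnePoint ℂ)) ''
        closure (Metric.ball ((S.center a : ℂ)) (S.radius a)) := by
    rw [← S.maps a]
    refine Set.mem_image_of_mem _ ?_
    rintro ⟨w, hw, hwx⟩
    exact hx (by rw [mem_Ireal_iff, ← OnePoint.coe_injective hwx]; exact hw)
  by_cases h0 : mobiusDen (S.g a) x = 0
  · rw [mobiusS_ofReal_eq_infty _ h0] at hmem
    obtain ⟨w, -, hw⟩ := hmem
    exact absurd hw (OnePoint.coe_ne_infty w)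
  · refine ⟨h0, ?_⟩
    rw [mobiusS_ofReal _ h0] at hmem
    obtain ⟨w, hw, hwx⟩ := hmem
    rw [mem_Jreal_iff, ← OnePoint.coe_injective hwx]
    exact hw

theorem g_infty (a : Fin (2 * S.r)) :
    (S.g a).1 1 0 ≠ 0 ∧ (S.g a).1 0 0 / (S.g a).1 1 0 ∈ S.Jreal a := by
  have hmem : mobiusS (S.g a) OnePoint.infty ∈
      (fun w : ℂ => (w : OnePoint ℂ)) ''
        closure (Metric.ball ((S.center a : ℂ)) (S.radius a)) := by
    rw [← S.maps a]
    refine Set.mem_image_of_mem _ ?_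
    rintro ⟨w, hw, hwx⟩
    exact OnePoint.coe_ne_infty w hwx
  rw [mobiusS_infty] at hmem
  obtain ⟨w, hw, hwx⟩ := hmem
  split_ifs at hwx with h
  · exact absurd hwx (OnePoint.coe_ne_infty w)
  · exact ⟨h, by rw [mem_Jreal_iff, ← OnePoint.coe_injective hwx]; exact hw⟩

theorem g_exterior_open (a : Fin (2 * S.r)) {x : ℝ} (hx : x ∉ S.Jreal (wordBar a)) :
    mobiusDen (S.g a) x ≠ 0 ∧ mobiusR (S.g a) x ∈ S.Ireal a := by
  obtain ⟨h0, -⟩ := S.g_exterior a fun h => hx (S.Ireal_subset_Jreal _ h)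
  refine ⟨h0, ?_⟩
  by_contra hI
  have := (S.g_exterior (wordBar a) (x := mobiusR (S.g a) x) (by rwa [wordBar_wordBar])).2
  rw [S.g_bar, mobiusR_inv_mobiusR _ h0] at this
  exact hx this

theorem g_mem_Ireal {a b : Fin (2 * S.r)} (hab : a ≠ wordBar b) {x : ℝ} (hx : x ∈ S.Jreal b) :
    mobiusDen (S.g a) x ≠ 0 ∧ mobiusR (S.g a) x ∈ S.Ireal a :=
  S.g_exterior_open a fun h => hab (wordBar_eq_comm.1 (S.eq_of_mem_Jreal h hx))

theorem wprod_nil : S.wprod [] = 1 := rfl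

theorem wprod_cons (a : Fin (2 * S.r)) (w : List (Fin (2 * S.r))) :
    S.wprod (a :: w) = S.g a * S.wprod w := by simp [wprod]

theorem wprod_append (w v : List (Fin (2 * S.r))) :
    S.wprod (w ++ v) = S.wprod w * S.wprod v := by simp [wprod]

theorem wprod_singleton (a : Fin (2 * S.r)) : S.wprod [a] = S.g a := by simp [wprod]

theorem wprod_mirror (w : List (Fin (2 * S.r))) : S.wprod (mirror w) = (S.wprod w)⁻¹ := by
  induction w with
  | nil => simp [mirror_nil, wprod_nil]
  | cons a w ih =>
    rw [← List.singleton_append, mirror_append, wprod_append, wprod_append, ih, mirror_singleton,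
      wprod_singleton, wprod_singleton, S.g_bar, mul_inv_rev]

/-- A word maps the closed intervals it may precede into the open interval of its first letter. -/
theorem wprod_mem_Ireal {w : List (Fin (2 * S.r))} {b : Fin (2 * S.r)} (hw : IsWord w)
    (hwb : arrow w [b]) {x : ℝ} (hx : x ∈ S.Jreal b) :
    mobiusDen (S.wprod w) x ≠ 0 ∧ ∀ a ∈ w.head?, mobiusR (S.wprod w) x ∈ S.Ireal a := by
  induction w with
  | nil => simp [wprod_nil, mobiusDen_one]
  | cons a v ih =>
    rw [isWord_cons] at hw
    rcases v with _ | ⟨e, v⟩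
    · rw [wprod_singleton]
      simpa using S.g_mem_Ireal (by simpa [arrow] using hwb) hx
    · obtain ⟨h1, h2⟩ := ih hw.2 (by simpa [arrow] using hwb)
      obtain ⟨h3, h4⟩ := S.g_mem_Ireal (hw.1 e rfl) (S.Ireal_subset_Jreal _ (h2 e rfl))
      rw [wprod_cons, mobiusDen_mul _ _ h1, mobiusR_mul _ _ h1]
      exact ⟨mul_ne_zero h3 h1, by simpa using h4⟩

theorem wprod_infty {w : List (Fin (2 * S.r))} {a : Fin (2 * S.r)} (hw : IsWord w)
    (ha : a ∈ w.head?) : (S.wprod w).1 1 0 ≠ 0 ∧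
      (S.wprod w).1 0 0 / (S.wprod w).1 1 0 ∈ S.Jreal a := by
  induction w generalizing a with
  | nil => simp at ha
  | cons a' v ih =>
    obtain rfl : a' = a := by simpa using ha
    rw [isWord_cons] at hw
    rcases v with _ | ⟨e, v⟩
    · rw [wprod_singleton]
      exact S.g_infty a'
    · obtain ⟨h1, h2⟩ := ih hw.2 (a := e) rfl
      obtain ⟨h3, h4⟩ := S.g_mem_Ireal (hw.1 e rfl) h2
      set v' := S.wprod (e :: v)
      have hC : (S.wprod (a' :: e :: v)).1 1 0 =
          v'.1 1 0 * mobiusDen (S.g a') (v'.1 0 0 / v'.1 1 0) := by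
        rw [wprod_cons, SL2.mul_eq, mobiusDen]
        field_simp
        rfl
      have hA : (S.wprod (a' :: e :: v)).1 0 0 =
          v'.1 1 0 * ((S.g a').1 0 0 * (v'.1 0 0 / v'.1 1 0) + (S.g a').1 0 1) := by
        rw [wprod_cons, SL2.mul_eq]
        field_simp
        rfl
      rw [hC, hA, mul_div_mul_left _ _ h1]
      exact ⟨mul_ne_zero h1 h3, S.Ireal_subset_Jreal _ h4⟩

theorem wprod_pole {w : List (Fin (2 * S.r))} {a : Fin (2 * S.r)} (hw : IsWord w)
    (ha : a ∈ w.getLast?) : (S.wprod w).1 1 0 ≠ 0 ∧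
      -(S.wprod w).1 1 1 / (S.wprod w).1 1 0 ∈ S.Jreal (wordBar a) := by
  have h := S.wprod_infty (isWord_mirror hw) (a := wordBar a) (by rw [head?_mirror, ha]; rfl)
  rw [wprod_mirror, (SL2.inv_eq _).1, (SL2.inv_eq _).2.2.1] at h
  refine ⟨by simpa using h.1, ?_⟩
  rw [neg_div, ← div_neg]
  exact h.2

theorem wprod_ne_one {w : List (Fin (2 * S.r))} (hw : IsWord w) (hne : w ≠ []) :
    S.wprod w ≠ 1 := by
  intro h
  obtain ⟨a, v, rfl⟩ := List.exists_cons_of_ne_nil hne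
  have := (S.wprod_infty hw (a := a) rfl).1
  rw [h] at this
  simp at this

/-- The Schottky group is free: distinct reduced words give distinct elements. -/
theorem wprod_injective {w v : List (Fin (2 * S.r))} (hw : IsWord w) (hv : IsWord v)
    (h : S.wprod w = S.wprod v) : w = v := by
  induction w generalizing v with
  | nil =>
    by_contra hne
    exact S.wprod_ne_one hv (Ne.symm hne) h.symm
  | cons a w ih =>
    rcases v with _ | ⟨b, v⟩
    · exact absurd h (S.wprod_ne_one hw (by simp))
    · have h1 := (S.wprod_infty hw (a := a) rfl).2
      rw [h] at h1
      obtain rfl := S.eq_of_mem_Jreal h1 (S.wprod_infty hv (a := b) rfl).2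
      rw [wprod_cons, wprod_cons, mul_right_inj] at h
      rw [ih (isWord_cons.1 hw).2 (isWord_cons.1 hv).2 h]

end Schottky

section Words

variable {r : ℕ}

theorem wordBar_ne (hr : 0 < r) (a : Fin (2 * r)) : a ≠ wordBar a := by
  intro h
  have h' := congrArg Fin.val h
  have ha := a.isLt
  simp only [wordBar] at h'
  rcases lt_or_ge (a.1 + r) (2 * r) with h1 | h1
  · rw [Nat.mod_eq_of_lt h1] at h'
    omega
  · rw [Nat.mod_eq_sub_mod h1, Nat.mod_eq_of_lt (show a.1 + r - 2 * r < 2 * r by omega)] at h'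
    omega

/-- Every reduced word is conjugate, without cancellation, to a cyclically reduced one. -/
theorem exists_cyclic_core (hr : 0 < r) (w : List (Fin (2 * r))) :
    ∃ c p, w = c ++ p ++ mirror c ∧ arrow p p := by
  induction w using List.bidirectionalRec with
  | nil => exact ⟨[], [], rfl, by simp [arrow]⟩
  | singleton a => exact ⟨[], [a], rfl, by simpa [arrow] using wordBar_ne hr a⟩
  | cons_append a l b ih =>
    by_cases h : b = wordBar a
    · obtain ⟨c, p, hl, hp⟩ := ih
      refine ⟨a :: c, p, ?_, hp⟩
      rw [← List.singleton_append (x := a) (l := c), mirror_append, mirror_singleton, hl, h]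
      simp
    · exact ⟨[], a :: (l ++ [b]), by simp [mirror_nil], by
        simp [arrow, List.getLast?_cons]
        exact h⟩

/-- The concatenation of `n` copies of a word. -/
def wordPow (p : List (Fin (2 * r))) (n : ℕ) : List (Fin (2 * r)) := (List.replicate n p).flatten

theorem wordPow_zero (p : List (Fin (2 * r))) : wordPow p 0 = [] := rfl

theorem wordPow_succ (p : List (Fin (2 * r))) (n : ℕ) : wordPow p (n + 1) = p ++ wordPow p n := rfl

theorem length_wordPow (p : List (Fin (2 * r))) (n : ℕ) :
    (wordPow p n).length = n * p.length := by simp [wordPow]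

theorem head?_wordPow_succ {p : List (Fin (2 * r))} (hp : p ≠ []) (n : ℕ) :
    (wordPow p (n + 1)).head? = p.head? := by
  obtain ⟨a, v, rfl⟩ := List.exists_cons_of_ne_nil hp
  rfl

theorem getLast?_wordPow_succ {p : List (Fin (2 * r))} (hp : p ≠ []) (n : ℕ) :
    (wordPow p (n + 1)).getLast? = p.getLast? := by
  induction n with
  | zero => simp [wordPow_succ, wordPow_zero]
  | succ n ih =>
    rw [wordPow_succ, List.getLast?_append, ih, List.getLast?_eq_some_getLast hp]
    rfl

theorem isWord_wordPow {p : List (Fin (2 * r))} (hp : IsWord p) (hpp : arrow p p) (n : ℕ) :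
    IsWord (wordPow p n) := by
  induction n with
  | zero => exact isWord_nil
  | succ n ih =>
    rw [wordPow_succ, isWord_append]
    refine ⟨hp, ih, ?_⟩
    rcases n with _ | n
    · simp [arrow, wordPow_zero]
    by_cases hp0 : p = []
    · simp [arrow, hp0]
    rw [arrow, head?_wordPow_succ hp0]
    exact hpp

theorem isWord_conj_wordPow {c p : List (Fin (2 * r))} (hw : IsWord (c ++ p ++ mirror c))
    (hp : p ≠ []) (hpp : arrow p p) {n : ℕ} (hn : n ≠ 0) :
    IsWord (c ++ wordPow p n ++ mirror c) := by
  obtain ⟨n, rfl⟩ := Nat.exists_eq_succ_of_ne_zero hn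
  obtain ⟨h1, h2, h3⟩ := isWord_append.1 hw
  obtain ⟨h4, h5, h6⟩ := isWord_append.1 h1
  have hq : wordPow p (n + 1) ≠ [] := by simp [wordPow_succ, hp]
  refine isWord_append.2 ⟨isWord_append.2 ⟨h4, isWord_wordPow h5 hpp _, ?_⟩, h2, ?_⟩
  · rwa [arrow, Nat.succ_eq_add_one, head?_wordPow_succ hp]
  · rw [arrow, Nat.succ_eq_add_one, List.getLast?_append, getLast?_wordPow_succ hp]
    rwa [arrow, List.getLast?_append] at h3

/-- Splitting two lists along a common prefix and a common suffix. -/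
theorem exists_split_of_take_eq {α : Type*} {w v : List α} {L M₁ M₂ R : ℕ}
    (hw : w.length = L + M₁ + R) (hv : v.length = L + M₂ + R) (hL : w.take L = v.take L)
    (hL' : ¬ ∃ x, w[L]? = some x ∧ v[L]? = some x)
    (hR : w.reverse.take R = v.reverse.take R)
    (hR' : ¬ ∃ x, w.reverse[R]? = some x ∧ v.reverse[R]? = some x) :
    ∃ x u t z, w = x ++ u ++ z ∧ v = x ++ t ++ z ∧ x.length = L ∧ u.length = M₁ ∧
      t.length = M₂ ∧ z.length = R ∧ (u ≠ [] → t ≠ [] → u.head? ≠ t.head?) ∧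
      (u ≠ [] → t ≠ [] → u.getLast? ≠ t.getLast?) := by
  have key : ∀ {w : List α} {M : ℕ}, w.length = L + M + R →
      ∃ x u z, w = x ++ u ++ z ∧ x.length = L ∧ u.length = M ∧ z.length = R := by
    intro w M h
    refine ⟨w.take L, (w.drop L).take M, w.drop (L + M), ?_, ?_, ?_, ?_⟩
    · rw [← List.drop_drop, List.append_assoc, List.take_append_drop, List.take_append_drop]
    all_goals simp; try omega
  obtain ⟨x, u, z, rfl, hx, hu, hz⟩ := key hw
  obtain ⟨x', t, z', rfl, hx', ht, hz'⟩ := key hv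
  have e1 : x = x' := by
    simpa [List.append_assoc, List.take_append_of_le_length, hx, hx'] using hL
  have e2 : z = z' := by
    have : z.reverse = z'.reverse := by
      simpa [List.reverse_append, hz, hz', List.take_append_of_le_length] using hR
    exact List.reverse_injective this
  subst e1 e2
  refine ⟨x, u, t, z, rfl, rfl, hx, hu, ht, hz, fun h1 h2 h => hL' ?_, fun h1 h2 h => hR' ?_⟩
  · obtain ⟨a, u, rfl⟩ := List.exists_cons_of_ne_nil h1
    refine ⟨a, ?_, ?_⟩
    · simp [← hx]
    · obtain ⟨b, t, rfl⟩ := List.exists_cons_of_ne_nil h2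
      obtain rfl : a = b := by simpa using h
      simp [← hx]
  · refine ⟨u.getLast h1, ?_, ?_⟩
    · rw [List.reverse_append, List.reverse_append, List.getElem?_append_right (by simp [hz]),
        List.length_reverse, hz, Nat.sub_self,
        List.getElem?_append_left (by simpa using List.length_pos_iff.2 h1),
        ← List.head?_eq_getElem?, List.head?_reverse, List.getLast?_eq_some_getLast h1]
    · rw [List.reverse_append, List.reverse_append, List.getElem?_append_right (by simp [hz]),
        List.length_reverse, hz, Nat.sub_self,
        List.getElem?_append_left (by simpa using List.length_pos_iff.2 h2),
        ← List.head?_eq_getElem?, List.head?_reverse, ← h, List.getLast?_eq_some_getLast h1]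

end Words

namespace Schottky

variable (S : Schottky)

theorem r_pos : 0 < S.r := lt_of_lt_of_le two_pos S.two_le_r

theorem wprod_wordPow (p : List (Fin (2 * S.r))) (n : ℕ) :
    S.wprod (wordPow p n) = S.wprod p ^ n := by
  induction n with
  | zero => simp [wordPow_zero, wprod_nil]
  | succ n ih => rw [wordPow_succ, wprod_append, ih, pow_succ']

theorem exists_reduced (l : List (Fin (2 * S.r))) :
    ∃ w, IsWord w ∧ S.wprod w = S.wprod l ∧ w.length ≤ l.length := by
  induction l with
  | nil => exact ⟨[], isWord_nil, rfl, le_rfl⟩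
  | cons a l ih =>
    obtain ⟨w, hw, hwl, hlen⟩ := ih
    by_cases h : ∀ y ∈ w.head?, a ≠ wordBar y
    · exact ⟨a :: w, isWord_cons.2 ⟨h, hw⟩, by rw [wprod_cons, wprod_cons, hwl], by simpa⟩
    · push Not at h
      obtain ⟨y, hy, rfl⟩ := h
      rcases w with _ | ⟨b, w⟩
      · simp at hy
      obtain rfl : b = y := by simpa using hy
      refine ⟨w, (isWord_cons.1 hw).2, ?_, ?_⟩
      · rw [wprod_cons, ← hwl, wprod_cons, S.g_bar, inv_mul_cancel_left]
      · simp at hlen ⊢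
        omega

theorem exists_word_of_mem_SGroup {γ : SL2} (h : γ ∈ S.SGroup) :
    ∃ w, IsWord w ∧ S.wprod w = γ := by
  have : ∃ l, S.wprod l = γ := by
    induction h using Subgroup.closure_induction with
    | mem x hx =>
      obtain ⟨a, rfl⟩ := hx
      exact ⟨[a], S.wprod_singleton a⟩
    | one => exact ⟨[], rfl⟩
    | mul x y _ _ hx hy =>
      obtain ⟨l, rfl⟩ := hx
      obtain ⟨l', rfl⟩ := hy
      exact ⟨l ++ l', S.wprod_append l l'⟩
    | inv x _ hx =>
      obtain ⟨l, rfl⟩ := hx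
      exact ⟨mirror l, S.wprod_mirror l⟩
  obtain ⟨l, rfl⟩ := this
  obtain ⟨w, hw, hwl, -⟩ := S.exists_reduced l
  exact ⟨w, hw, hwl⟩

/-- The reduced word of a nontrivial power is a conjugated periodic word. -/
theorem exists_word_pow {γ : SL2} (h : γ ∈ S.SGroup) (hγ : γ ≠ 1) {q : ℕ} (hq : q ≠ 0) :
    ∃ c p, p ≠ [] ∧ IsWord (c ++ wordPow p q ++ mirror c) ∧
      S.wprod (c ++ wordPow p q ++ mirror c) = γ ^ q := by
  obtain ⟨w, hw, rfl⟩ := S.exists_word_of_mem_SGroup h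
  obtain ⟨c, p, rfl, hpp⟩ := exists_cyclic_core S.r_pos w
  have hp : p ≠ [] := by
    rintro rfl
    apply hγ
    rw [List.append_nil, wprod_append, wprod_mirror, mul_inv_cancel]
  refine ⟨c, p, hp, isWord_conj_wordPow hw hp hpp hq, ?_⟩
  rw [wprod_append, wprod_append, wprod_append, wprod_append, wprod_mirror, wprod_wordPow, conj_pow]

theorem le_length_of_pow_eq {γ : SL2} (h : γ ∈ S.SGroup) {q : ℕ} (hne : γ ^ q ≠ 1)
    {l : List (Fin (2 * S.r))} (hl : S.wprod l = γ ^ q) : q ≤ l.length := by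
  have hq : q ≠ 0 := by
    rintro rfl
    exact hne (pow_zero _)
  have hγ : γ ≠ 1 := by
    rintro rfl
    exact hne (one_pow _)
  obtain ⟨c, p, hp, hw, hwq⟩ := S.exists_word_pow h hγ hq
  obtain ⟨w, hw', hwl, hlen⟩ := S.exists_reduced l
  have heq := S.wprod_injective hw' hw (by rw [hwl, hl, hwq])
  rw [heq] at hlen
  simp only [List.length_append, length_wordPow] at hlen
  have : 0 < p.length := List.length_pos_iff.2 hp
  nlinarith

theorem exists_wordPow_eq {γ : SL2} (h : γ ∈ S.SGroup) {q : ℕ} (hq : q ≠ 0)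
    {l : List (Fin (2 * S.r))} (hw : IsWord l) (hne : l ≠ []) (hll : arrow l l)
    (hl : S.wprod l = γ ^ q) : ∃ p, l = wordPow p q := by
  have hγ : γ ≠ 1 := by
    rintro rfl
    exact S.wprod_ne_one hw hne (by rw [hl, one_pow])
  obtain ⟨c, p, hp, hw', hwq⟩ := S.exists_word_pow h hγ hq
  have heq := S.wprod_injective hw hw' (by rw [hl, hwq])
  rcases c with _ | ⟨a, c⟩
  · exact ⟨p, by simpa [mirror_nil] using heq⟩
  · exfalso
    refine hll (wordBar a) ?_ a ?_ rfl
    · rw [heq, ← List.singleton_append (x := a) (l := c), mirror_append, mirror_singleton,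
        ← List.append_assoc, List.getLast?_append]
      rfl
    · rw [heq]
      rfl

variable {S}

theorem PowerPairsQ.ne_one {τ : ℝ} {q : ℕ} {p : List (Fin (2 * S.r)) × List (Fin (2 * S.r))}
    (hp : p ∈ S.PowerPairsQ τ q) : S.wprod p.1.dropLast * (S.wprod p.2.dropLast)⁻¹ ≠ 1 :=
  fun h => hp.2.2.2 (q + 1) (Nat.lt_succ_self q) ⟨1, one_mem _, by rw [h, one_pow]⟩

theorem PowerPairsPart.swap {τ : ℝ} {L M₁ M₂ R q : ℕ}
    {p : List (Fin (2 * S.r)) × List (Fin (2 * S.r))} (hp : p ∈ S.PowerPairsPart τ L M₁ M₂ R q) :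
    p.swap ∈ S.PowerPairsPart τ L M₂ M₁ R q := by
  obtain ⟨⟨h1, h2, ⟨γ, hγ, hγq⟩, h4⟩, h5, h6, h7, h8, h9, h10⟩ := hp
  refine ⟨⟨h2, h1, ⟨γ⁻¹, inv_mem hγ, ?_⟩, ?_⟩, h6, h5, h7.symm, ?_, h9.symm, ?_⟩
  · rw [inv_pow, ← hγq]
    simp
  · rintro q' hq' ⟨γ₁, hγ₁, h⟩
    refine h4 q' hq' ⟨γ₁⁻¹, inv_mem hγ₁, ?_⟩
    rw [inv_pow, ← h]
    simp
  · rintro ⟨x, hx, hx'⟩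
    exact h8 ⟨x, hx', hx⟩
  · rintro ⟨x, hx, hx'⟩
    exact h10 ⟨x, hx', hx⟩

theorem PowerPairsPart.exists_split {τ : ℝ} {L M₁ M₂ R q : ℕ} (hq : q ≠ 0)
    {p : List (Fin (2 * S.r)) × List (Fin (2 * S.r))} (hp : p ∈ S.PowerPairsPart τ L M₁ M₂ R q) :
    ∃ x u t z, p.1.dropLast = x ++ u ++ z ∧ p.2.dropLast = x ++ t ++ z ∧ x.length = L ∧
      u.length = M₁ ∧ t.length = M₂ ∧ z.length = R ∧
      (u ≠ [] → t ≠ [] → ∃ e, u ++ mirror t = wordPow e q) := by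
  obtain ⟨⟨hp1, hp2, ⟨γ, hγ, hγq⟩, -⟩, h5, h6, h7, h8, h9, h10⟩ := hp
  obtain ⟨x, u, t, z, hw, hv, hx, hu, ht, hz, hhead, hlast⟩ :=
    exists_split_of_take_eq h5 h6 h7 h8 h9 h10
  refine ⟨x, u, t, z, hw, hv, hx, hu, ht, hz, fun hu0 ht0 => ?_⟩
  have hW : IsWord (x ++ u ++ z) := hw ▸ List.IsChain.dropLast hp1.1
  have hV : IsWord (x ++ t ++ z) := hv ▸ List.IsChain.dropLast hp2.1
  have hU : IsWord u := (isWord_append.1 (isWord_append.1 hW).1).2.1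
  have hT : IsWord t := (isWord_append.1 (isWord_append.1 hV).1).2.1
  refine S.exists_wordPow_eq (γ := (S.wprod x)⁻¹ * γ * (S.wprod x)) ?_ hq ?_ (by simp [hu0]) ?_ ?_
  · exact mul_mem (mul_mem (inv_mem (S.wprod_mem x)) hγ) (S.wprod_mem x)
  · refine isWord_append.2 ⟨hU, isWord_mirror hT, fun a ha b hb hab => hlast hu0 ht0 ?_⟩
    rw [head?_mirror, Option.mem_map] at hb
    obtain ⟨e, he, rfl⟩ := hb
    rw [wordBar_wordBar] at hab
    rw [ha, he, hab]
  · intro a ha b hb hab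
    refine hhead hu0 ht0 ?_
    have hm : mirror t ≠ [] := fun h => ht0 (by rw [← mirror_mirror t, h, mirror_nil])
    rw [List.getLast?_append_of_ne_nil _ hm, getLast?_mirror, Option.mem_map] at ha
    rw [List.head?_append_of_ne_nil _ hu0] at hb
    obtain ⟨e, he, rfl⟩ := ha
    rw [wordBar_eq_comm, wordBar_wordBar] at hab
    rw [hb, he, hab]
  · have hc := conj_pow (i := q) (a := (S.wprod x)⁻¹) (b := γ)
    rw [inv_inv] at hc
    rw [hc, ← hγq, hw, hv]
    simp only [wprod_append, wprod_mirror]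
    group

/-- The larger of the two words determines the smaller one. -/
theorem PowerPairsPart.dropLast_snd_eq {τ : ℝ} {L M₁ M₂ R q : ℕ} (hq : 2 ≤ q) (hM : M₂ ≤ M₁)
    {p p' : List (Fin (2 * S.r)) × List (Fin (2 * S.r))} (hp : p ∈ S.PowerPairsPart τ L M₁ M₂ R q)
    (hp' : p' ∈ S.PowerPairsPart τ L M₁ M₂ R q) (h : p.1 = p'.1) :
    p.2.dropLast = p'.2.dropLast := by
  obtain ⟨x, u, t, z, h1, h2, hx, hu, ht, hz, hpow⟩ := PowerPairsPart.exists_split (by omega) hp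
  obtain ⟨x', u', t', z', h1', h2', hx', hu', ht', hz', hpow'⟩ :=
    PowerPairsPart.exists_split (by omega) hp'
  rw [h, h1'] at h1
  obtain ⟨h3, rfl⟩ := List.append_inj' h1 (by rw [hz, hz'])
  obtain ⟨rfl, rfl⟩ := List.append_inj h3 (by rw [hx, hx'])
  suffices t = t' by rw [h2, h2', this]
  rcases Nat.eq_zero_or_pos M₂ with h0 | h0
  · subst h0
    rw [List.length_eq_zero_iff.1 ht, List.length_eq_zero_iff.1 ht']
  have hu0 : u' ≠ [] := List.length_pos_iff.1 (by omega)
  obtain ⟨e, he⟩ := hpow hu0 (List.length_pos_iff.1 (by omega))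
  obtain ⟨e', he'⟩ := hpow' hu0 (List.length_pos_iff.1 (by omega))
  have hl := congrArg List.length he
  have hl' := congrArg List.length he'
  rw [List.length_append, length_mirror, length_wordPow] at hl hl'
  have hee : e.length = e'.length :=
    Nat.eq_of_mul_eq_mul_left (show 0 < q by omega) (by rw [← hl, ← hl', ht, ht'])
  have hle : e.length ≤ u'.length := by nlinarith
  have hpre : ∀ {e s : List (Fin (2 * S.r))}, e.length ≤ u'.length → u' ++ s = wordPow e q →
      e = u'.take e.length := by
    intro e s hle h
    obtain ⟨n, rfl⟩ := Nat.exists_eq_add_of_le' (show 1 ≤ q by omega)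
    have := congrArg (List.take e.length) h
    rw [wordPow_succ, List.take_append_of_le_length hle, List.take_left] at this
    exact this.symm
  have : e = e' := by rw [hpre hle he, hpre (hee ▸ hle) he', hee]
  rw [this, ← he'] at he
  exact mirror_injective (List.append_cancel_left he)

end Schottky

theorem exists_pos_forall_le {ι : Type*} [Finite ι] (f : ι → ℝ) (hf : ∀ i, 0 < f i) :
    ∃ η > 0, ∀ i, η ≤ f i := by
  rcases isEmpty_or_nonempty ι with h | h
  · exact ⟨1, one_pos, fun i => (h.false i).elim⟩
  · obtain ⟨i₀, hi₀⟩ := Finite.exists_min f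
    exact ⟨f i₀, hf i₀, hi₀⟩

theorem exists_forall_le {ι : Type*} [Finite ι] (f : ι → ℝ) : ∃ C, 1 ≤ C ∧ ∀ i, f i ≤ C := by
  rcases isEmpty_or_nonempty ι with h | h
  · exact ⟨1, le_rfl, fun i => (h.false i).elim⟩
  · obtain ⟨i₀, hi₀⟩ := Finite.exists_max f
    exact ⟨max 1 (f i₀), le_max_left _ _, fun i => (hi₀ i).trans (le_max_right _ _)⟩

namespace Schottky

variable (S : Schottky)

theorem exists_dist_bounds : ∃ g₀ Δ : ℝ, 0 < g₀ ∧ g₀ ≤ 1 ∧ 1 ≤ Δ ∧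
    ∀ a b, a ≠ b → ∀ p ∈ S.Jreal a, ∀ x ∈ S.Jreal b, g₀ ≤ |x - p| ∧ |x - p| ≤ Δ := by
  have hlow : ∀ q : Fin (2 * S.r) × Fin (2 * S.r), ∃ η > 0, q.1 ≠ q.2 → ∀ p ∈ S.Jreal q.1,
      ∀ x ∈ S.Jreal q.2, η ≤ |x - p| := by
    rintro ⟨a, b⟩
    by_cases hab : a = b
    · exact ⟨1, one_pos, fun h => absurd hab h⟩
    obtain ⟨δ, hδ, h⟩ := Metric.exists_pos_forall_lt_edist (isCompact_Icc : IsCompact (S.Jreal b))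
      (isClosed_Icc : IsClosed (S.Jreal a)) (S.disjoint_Jreal (Ne.symm hab))
    refine ⟨δ, hδ, fun _ p hp x hx => ?_⟩
    have := h x hx p hp
    rw [edist_nndist, ENNReal.coe_lt_coe] at this
    have h' : (δ : ℝ) < dist x p := by exact_mod_cast this
    rw [Real.dist_eq] at h'
    exact h'.le
  choose η hη h using hlow
  obtain ⟨g₀, hg₀, hg⟩ := exists_pos_forall_le η hη
  obtain ⟨Δ, hΔ, hd⟩ := exists_forall_le fun q : Fin (2 * S.r) × Fin (2 * S.r) =>
    |S.center q.2 - S.center q.1| + S.radius q.1 + S.radius q.2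
  refine ⟨min g₀ 1, Δ, lt_min hg₀ one_pos, min_le_right _ _, hΔ, fun a b hab p hp x hx =>
    ⟨(min_le_left _ _).trans ((hg (a, b)).trans (h (a, b) hab p hp x hx)), ?_⟩⟩
  have h1 := hd (a, b)
  obtain ⟨hp1, hp2⟩ := hp
  obtain ⟨hx1, hx2⟩ := hx
  have h2 := abs_le.1 (le_refl |S.center b - S.center a|)
  refine (abs_le.2 ⟨?_, ?_⟩).trans h1 <;> simp only <;> linarith [h2.1, h2.2]

/-- The square of the lower left entry of `γ_w`, which measures the inverse size of `I_w`. -/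
noncomputable def wordSq (w : List (Fin (2 * S.r))) : ℝ :=
  if w = [] then 1 else (S.wprod w).1 1 0 ^ 2

theorem wordSq_nil : S.wordSq [] = 1 := if_pos rfl

theorem wordSq_of_ne_nil {w : List (Fin (2 * S.r))} (h : w ≠ []) :
    S.wordSq w = (S.wprod w).1 1 0 ^ 2 := if_neg h

theorem wordSq_pos {w : List (Fin (2 * S.r))} (hw : IsWord w) : 0 < S.wordSq w := by
  rcases w with _ | ⟨a, w⟩
  · rw [wordSq_nil]
    exact one_pos
  · rw [wordSq_of_ne_nil _ (by simp)]
    have := (S.wprod_infty hw (a := a) rfl).1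
    positivity

theorem exists_wordSq_append_le : ∃ K : ℝ, 1 ≤ K ∧
    (∀ w v, IsWord (w ++ v) → S.wordSq (w ++ v) ≤ K * (S.wordSq w * S.wordSq v)) ∧
    ∀ w b, IsWord (w ++ [b]) → S.wordSq (w ++ [b]) ≤ K * S.wordSq w := by
  obtain ⟨g₀, Δ, -, -, hΔ, hd⟩ := S.exists_dist_bounds
  have hΔ2 : 1 ≤ Δ ^ 2 := one_le_pow₀ hΔ
  have h1 : ∀ w v, IsWord (w ++ v) → S.wordSq (w ++ v) ≤ Δ ^ 2 * (S.wordSq w * S.wordSq v) := by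
    intro w v h
    obtain ⟨hw, hv, hwv⟩ := isWord_append.1 h
    by_cases hw0 : w = []
    · subst hw0
      rw [wordSq_nil, one_mul, List.nil_append]
      nlinarith [S.wordSq_pos hv]
    by_cases hv0 : v = []
    · subst hv0
      rw [wordSq_nil, mul_one, List.append_nil]
      nlinarith [S.wordSq_pos hw]
    rw [wordSq_of_ne_nil _ hw0, wordSq_of_ne_nil _ hv0, wordSq_of_ne_nil _ (by simp [hw0])]
    obtain ⟨hc, hp⟩ := S.wprod_pole hw (List.getLast?_eq_some_getLast hw0)
    obtain ⟨hc', hp'⟩ := S.wprod_infty hv (List.head?_eq_some_head hv0)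
    have hne : wordBar (w.getLast hw0) ≠ v.head hv0 := fun h =>
      hwv _ (List.getLast?_eq_some_getLast hw0) _ (List.head?_eq_some_head hv0)
        (wordBar_eq_comm.1 h)
    have hdist := (hd _ _ hne _ hp _ hp').2
    have hC : (S.wprod (w ++ v)).1 1 0 = (S.wprod w).1 1 0 * (S.wprod v).1 1 0 *
        ((S.wprod v).1 0 0 / (S.wprod v).1 1 0 -
          -(S.wprod w).1 1 1 / (S.wprod w).1 1 0) := by
      rw [wprod_append, SL2.mul_eq]
      field_simp
      ring
    rw [hC, mul_pow, mul_pow, mul_comm]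
    exact mul_le_mul_of_nonneg_right (sq_le_sq' (neg_le_of_abs_le hdist) (le_of_abs_le hdist))
      (by positivity)
  obtain ⟨B, hB, hb⟩ := exists_forall_le fun b : Fin (2 * S.r) => S.wordSq [b]
  refine ⟨Δ ^ 2 * B, one_le_mul_of_one_le_of_one_le hΔ2 hB, fun w v h => (h1 w v h).trans ?_,
    fun w b h => (h1 w [b] h).trans ?_⟩
  · obtain ⟨hw, hv, -⟩ := isWord_append.1 h
    have := S.wordSq_pos hw
    have := S.wordSq_pos hv
    gcongr
    exact le_mul_of_one_le_right (by positivity) hB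
  · have := S.wordSq_pos (isWord_append.1 h).1
    rw [mul_assoc, mul_comm B]
    gcongr
    exact hb b

theorem exists_distortion : ∃ k₁ k₂ : ℝ, 0 < k₁ ∧ 0 < k₂ ∧ ∀ w b, IsWord (w ++ [b]) →
    ∀ x ∈ S.Jreal b, ∀ y ∈ S.Jreal b, x ≤ y →
      k₁ * (y - x) / S.wordSq w ≤ mobiusR (S.wprod w) y - mobiusR (S.wprod w) x ∧
      mobiusR (S.wprod w) y - mobiusR (S.wprod w) x ≤ k₂ * (y - x) / S.wordSq w := by
  obtain ⟨g₀, Δ, hg₀, hg₁, hΔ, hd⟩ := S.exists_dist_bounds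
  refine ⟨(Δ ^ 2)⁻¹, (g₀ ^ 2)⁻¹, by positivity, by positivity, fun w b h x hx y hy hxy => ?_⟩
  obtain ⟨hw, -, hwb⟩ := isWord_append.1 h
  have hyx : 0 ≤ y - x := sub_nonneg.2 hxy
  by_cases hw0 : w = []
  · subst hw0
    rw [wprod_nil, mobiusR_one, mobiusR_one, wordSq_nil, div_one, div_one]
    constructor
    · exact mul_le_of_le_one_left hyx (inv_le_one_of_one_le₀ (one_le_pow₀ hΔ))
    · exact le_mul_of_one_le_left hyx ((one_le_inv₀ (by positivity)).2 (pow_le_one₀ hg₀.le hg₁))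
  · have hx0 := (S.wprod_mem_Ireal hw hwb hx).1
    have hy0 := (S.wprod_mem_Ireal hw hwb hy).1
    rw [mobiusR_sub _ hx0 hy0, wordSq_of_ne_nil _ hw0]
    obtain ⟨hc, hp⟩ := S.wprod_pole hw (List.getLast?_eq_some_getLast hw0)
    have hne : wordBar (w.getLast hw0) ≠ b := fun h =>
      hwb _ (List.getLast?_eq_some_getLast hw0) b rfl (wordBar_eq_comm.1 h)
    set p := -(S.wprod w).1 1 1 / (S.wprod w).1 1 0 with hpdef
    set C := (S.wprod w).1 1 0 with hC
    have hden : ∀ z, mobiusDen (S.wprod w) z = C * (z - p) := by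
      intro z
      rw [mobiusDen, hpdef]
      field_simp
      ring
    obtain ⟨hx1, hx2⟩ := hd _ _ hne _ hp _ hx
    obtain ⟨hy1, hy2⟩ := hd _ _ hne _ hp _ hy
    have hprod : (x - p) * (y - p) = |x - p| * |y - p| := by
      rw [← abs_mul, abs_of_nonneg]
      by_contra hneg
      push Not at hneg
      have : p ∈ S.Jreal b := by
        obtain ⟨hx3, hx4⟩ := hx
        obtain ⟨hy3, hy4⟩ := hy
        constructor <;> nlinarith
      exact hne (S.eq_of_mem_Jreal hp this)
    have hlow : g₀ ^ 2 ≤ |x - p| * |y - p| := by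
      rw [sq]
      exact mul_le_mul hx1 hy1 hg₀.le (abs_nonneg _)
    have hup : |x - p| * |y - p| ≤ Δ ^ 2 := by
      rw [sq]
      exact mul_le_mul hx2 hy2 (abs_nonneg _) (by linarith)
    have hpos : 0 < |x - p| * |y - p| := lt_of_lt_of_le (by positivity) hlow
    rw [hden, hden, show C * (x - p) * (C * (y - p)) = (|x - p| * |y - p|) * C ^ 2 by
      rw [← hprod]; ring]
    rw [inv_mul_eq_div, inv_mul_eq_div, div_div, div_div]
    constructor
    · gcongr
    · gcongr

/-- Left endpoint of `I_a`. -/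
noncomputable def lo (a : Fin (2 * S.r)) : ℝ := S.center a - S.radius a

/-- Right endpoint of `I_a`. -/
noncomputable def hi (a : Fin (2 * S.r)) : ℝ := S.center a + S.radius a

theorem lo_lt_hi (a : Fin (2 * S.r)) : S.lo a < S.hi a := by
  have := S.radius_pos a
  rw [lo, hi]
  linarith

theorem lo_mem (a : Fin (2 * S.r)) : S.lo a ∈ S.Jreal a := Set.left_mem_Icc.2 (S.lo_lt_hi a).le

theorem hi_mem (a : Fin (2 * S.r)) : S.hi a ∈ S.Jreal a := Set.right_mem_Icc.2 (S.lo_lt_hi a).le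

theorem continuousOn_mobiusR_wprod {w : List (Fin (2 * S.r))} {b : Fin (2 * S.r)}
    (h : IsWord (w ++ [b])) : ContinuousOn (mobiusR (S.wprod w)) (S.Jreal b) := by
  obtain ⟨hw, -, hwb⟩ := isWord_append.1 h
  refine ContinuousOn.div ?_ ?_ fun x hx => (S.wprod_mem_Ireal hw hwb hx).1
  · fun_prop
  · fun_prop

theorem strictMonoOn_mobiusR_wprod {w : List (Fin (2 * S.r))} {b : Fin (2 * S.r)}
    (h : IsWord (w ++ [b])) : StrictMonoOn (mobiusR (S.wprod w)) (S.Jreal b) := by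
  intro x hx y hy hxy
  obtain ⟨k₁, k₂, hk₁, -, hk⟩ := S.exists_distortion
  have := (hk w b h x hx y hy hxy.le).1
  have h2 : 0 < k₁ * (y - x) / S.wordSq w :=
    div_pos (mul_pos hk₁ (sub_pos.2 hxy)) (S.wordSq_pos (isWord_append.1 h).1)
  linarith

theorem ups_concat {w : List (Fin (2 * S.r))} {b : Fin (2 * S.r)} (h : IsWord (w ++ [b])) :
    S.ups (w ++ [b]) = mobiusR (S.wprod w) (S.hi b) - mobiusR (S.wprod w) (S.lo b) := by
  have hmono := S.strictMonoOn_mobiusR_wprod h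
  have hne : w ++ [b] ≠ [] := by simp
  have himg : S.Iset (w ++ [b]) =
      Set.Ioo (mobiusR (S.wprod w) (S.lo b)) (mobiusR (S.wprod w) (S.hi b)) := by
    rw [Iset, dif_neg hne, List.dropLast_concat, List.getLast_concat, Ireal_eq]
    apply Set.Subset.antisymm
    · rintro _ ⟨x, ⟨hx1, hx2⟩, rfl⟩
      exact ⟨hmono (S.lo_mem b) ⟨hx1.le, hx2.le⟩ hx1, hmono ⟨hx1.le, hx2.le⟩ (S.hi_mem b) hx2⟩
    · exact intermediate_value_Ioo (S.lo_lt_hi b).le (S.continuousOn_mobiusR_wprod h)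
  rw [ups, if_neg hne, himg, Real.volume_Ioo, ENNReal.toReal_ofReal]
  exact sub_nonneg.2 (hmono (S.lo_mem b) (S.hi_mem b) (S.lo_lt_hi b)).le

theorem ups_pos {w : List (Fin (2 * S.r))} {b : Fin (2 * S.r)} (h : IsWord (w ++ [b])) :
    0 < S.ups (w ++ [b]) := by
  rw [S.ups_concat h]
  exact sub_pos.2 (S.strictMonoOn_mobiusR_wprod h (S.lo_mem b) (S.hi_mem b) (S.lo_lt_hi b))

theorem exists_ups_bounds : ∃ k₁ k₂ : ℝ, 0 < k₁ ∧ 0 < k₂ ∧ ∀ w b, IsWord (w ++ [b]) →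
    k₁ / S.wordSq w ≤ S.ups (w ++ [b]) ∧ S.ups (w ++ [b]) ≤ k₂ / S.wordSq w := by
  obtain ⟨k₁, k₂, hk₁, hk₂, hk⟩ := S.exists_distortion
  obtain ⟨η, hη, hlen⟩ := exists_pos_forall_le (fun b => S.hi b - S.lo b)
    fun b => sub_pos.2 (S.lo_lt_hi b)
  obtain ⟨C, hC, hlen'⟩ := exists_forall_le (fun b => S.hi b - S.lo b)
  refine ⟨k₁ * η, k₂ * C, by positivity, by positivity, fun w b h => ?_⟩
  have hpos := S.wordSq_pos (isWord_append.1 h).1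
  obtain ⟨h1, h2⟩ := hk w b h _ (S.lo_mem b) _ (S.hi_mem b) (S.lo_lt_hi b).le
  rw [S.ups_concat h]
  refine ⟨le_trans ?_ h1, h2.trans ?_⟩
  · have := hlen b
    gcongr
  · have := hlen' b
    gcongr

theorem exists_contraction : ∃ θ : ℝ, 0 < θ ∧ θ < 1 ∧ ∀ w b b', IsWord (w ++ [b] ++ [b']) →
    S.ups (w ++ [b] ++ [b']) ≤ θ * S.ups (w ++ [b]) := by
  obtain ⟨k₁, k₀, hk₁, -, hk⟩ := S.exists_distortion
  obtain ⟨k₃, k₂, -, hk₂, hk'⟩ := S.exists_ups_bounds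
  have hin : ∀ q : Fin (2 * S.r) × Fin (2 * S.r), ∃ η > 0, q.1 ≠ wordBar q.2 →
      η ≤ mobiusR (S.g q.1) (S.lo q.2) - S.lo q.1 := by
    rintro ⟨b, b'⟩
    by_cases h : b = wordBar b'
    · exact ⟨1, one_pos, fun h' => absurd h h'⟩
    · have := (S.g_mem_Ireal h (S.lo_mem b')).2
      rw [Ireal_eq] at this
      exact ⟨_, sub_pos.2 this.1, fun _ => le_rfl⟩
  choose η' hη' hη'' using hin
  obtain ⟨η, hη, hηq⟩ := exists_pos_forall_le η' hη'
  set ε := min (k₁ * η / k₂) (1 / 2) with hε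
  have hε0 : 0 < ε := lt_min (by positivity) (by norm_num)
  have hε1 : ε ≤ 1 / 2 := min_le_right _ _
  refine ⟨1 - ε, by linarith, by linarith, fun w b b' h => ?_⟩
  obtain ⟨hwb, -, hbb'⟩ := isWord_append.1 h
  have hw := (isWord_append.1 hwb).1
  have hb : b ≠ wordBar b' := arrow_concat_left.1 hbb' b' rfl
  have hpos := S.wordSq_pos hw
  obtain ⟨hl0, hl⟩ := S.g_mem_Ireal hb (S.lo_mem b')
  obtain ⟨hh0, hh⟩ := S.g_mem_Ireal hb (S.hi_mem b')
  have hhJ := S.Ireal_subset_Jreal _ hh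
  have hlJ := S.Ireal_subset_Jreal _ hl
  have h1 := (hk w b hwb _ (S.lo_mem b) _ hlJ hlJ.1).1
  have h2 : mobiusR (S.wprod w) (mobiusR (S.g b) (S.hi b')) ≤ mobiusR (S.wprod w) (S.hi b) :=
    (S.strictMonoOn_mobiusR_wprod hwb).monotoneOn hhJ (S.hi_mem b) hhJ.2
  have h3 : ε * S.ups (w ++ [b]) ≤ k₁ * (mobiusR (S.g b) (S.lo b') - S.lo b) / S.wordSq w := by
    calc ε * S.ups (w ++ [b]) ≤ (k₁ * η / k₂) * (k₂ / S.wordSq w) := by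
          exact mul_le_mul (min_le_left _ _) (hk' w b hwb).2 (S.ups_pos hwb).le (by positivity)
      _ = k₁ * η / S.wordSq w := by field_simp
      _ ≤ _ := by
          have := (hηq (b, b')).trans (hη'' (b, b') hb)
          gcongr
  rw [S.ups_concat h, wprod_append, wprod_singleton, mobiusR_mul _ _ hl0, mobiusR_mul _ _ hh0,
    sub_mul, one_mul]
  have h4 := S.ups_concat hwb
  linarith

end Schottky

namespace Schottky

variable (S : Schottky)

theorem exists_wordSq_le_pow : ∃ K : ℝ, 1 < K ∧ ∀ w, IsWord w → S.wordSq w ≤ K ^ w.length := by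
  obtain ⟨K, hK, -, h⟩ := S.exists_wordSq_append_le
  refine ⟨K + 1, by linarith, fun w hw => ?_⟩
  induction w using List.reverseRecOn with
  | nil => simp [wordSq_nil]
  | append_singleton w b ih =>
    have ih := ih (isWord_append.1 hw).1
    have hpos := S.wordSq_pos (isWord_append.1 hw).1
    rw [List.length_append, List.length_singleton, pow_succ']
    exact (h w b hw).trans (mul_le_mul (by linarith) ih hpos.le (by linarith))

theorem exists_ups_le_pow : ∃ k θ : ℝ, 0 < k ∧ 0 < θ ∧ θ < 1 ∧
    ∀ w b, IsWord (w ++ [b]) → S.ups (w ++ [b]) ≤ k * θ ^ w.length := by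
  obtain ⟨θ, hθ, hθ1, h⟩ := S.exists_contraction
  obtain ⟨k₁, k₂, -, hk₂, hk⟩ := S.exists_ups_bounds
  refine ⟨k₂, θ, hk₂, hθ, hθ1, fun w b hw => ?_⟩
  induction w using List.reverseRecOn generalizing b with
  | nil => simpa [wordSq_nil] using (hk [] b hw).2
  | append_singleton w b' ih =>
    rw [List.length_append, List.length_singleton, pow_succ, ← mul_assoc, mul_comm _ θ]
    exact (h w b' b hw).trans (mul_le_mul_of_nonneg_left (ih b' (isWord_append.1 hw).1) hθ.le)

theorem exists_length_bounds : ∃ D κ : ℝ, 1 < D ∧ 0 < κ ∧ ∀ τ : ℝ, 0 < τ → τ < 1 →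
    ∀ w b, w ++ [b] ∈ S.Zset τ →
      D⁻¹ * Real.log τ⁻¹ - κ ≤ w.length ∧ w.length ≤ D * Real.log τ⁻¹ + κ := by
  obtain ⟨K, hK, hsq⟩ := S.exists_wordSq_le_pow
  obtain ⟨k, θ, hk, hθ, hθ1, hups⟩ := S.exists_ups_le_pow
  obtain ⟨k₁, k₂, hk₁, -, hkb⟩ := S.exists_ups_bounds
  have hlK : 0 < Real.log K := Real.log_pos hK
  have hlθ : 0 < Real.log θ⁻¹ := Real.log_pos ((one_lt_inv₀ hθ).2 hθ1)
  refine ⟨2 + Real.log K + (Real.log θ⁻¹)⁻¹,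
    |Real.log k₁| / Real.log K + 1 + |Real.log k| / Real.log θ⁻¹, ?_, ?_, ?_⟩
  · have := inv_pos.2 hlθ
    linarith
  · positivity
  rintro τ hτ hτ1 w b ⟨hw, -, hle, hlt⟩
  have hlτ : 0 < Real.log τ⁻¹ := Real.log_pos ((one_lt_inv₀ hτ).2 hτ1)
  rw [List.dropLast_concat] at hlt
  have hpos1 : 0 ≤ |Real.log k₁| / Real.log K := by positivity
  have hpos2 : 0 ≤ |Real.log k| / Real.log θ⁻¹ := by positivity
  have hinv := inv_pos.2 hlθ
  constructor
  · have hw' := (isWord_append.1 hw).1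
    have h1 : k₁ / K ^ w.length ≤ τ :=
      (div_le_div_of_nonneg_left hk₁.le (S.wordSq_pos hw') (hsq w hw')).trans
        ((hkb w b hw).1.trans hle)
    have h2 := Real.log_le_log (by positivity) h1
    rw [Real.log_div hk₁.ne' (by positivity), Real.log_pow] at h2
    have h3 : Real.log τ⁻¹ - |Real.log k₁| ≤ w.length * Real.log K := by
      rw [Real.log_inv]
      linarith [neg_abs_le (Real.log k₁)]
    have h4 : Real.log τ⁻¹ / Real.log K - |Real.log k₁| / Real.log K ≤ w.length := by
      rwa [← sub_div, div_le_iff₀ hlK]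
    have h5 : (2 + Real.log K + (Real.log θ⁻¹)⁻¹)⁻¹ * Real.log τ⁻¹ ≤
        Real.log τ⁻¹ / Real.log K := by
      rw [div_eq_inv_mul]
      gcongr
      linarith
    linarith
  · rcases List.eq_nil_or_concat' w with rfl | ⟨v, e, rfl⟩
    · rw [List.length_nil, Nat.cast_zero]
      positivity
    · have h1 := hlt.trans_le (hups v e (isWord_append.1 hw).1)
      have h2 := Real.log_le_log hτ h1.le
      rw [Real.log_mul hk.ne' (by positivity), Real.log_pow] at h2
      have h3 : v.length * Real.log θ⁻¹ ≤ Real.log τ⁻¹ + |Real.log k| := by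
        rw [Real.log_inv, Real.log_inv]
        linarith [le_abs_self (Real.log k)]
      have h4 : (v.length : ℝ) ≤ (Real.log θ⁻¹)⁻¹ * Real.log τ⁻¹ +
          |Real.log k| / Real.log θ⁻¹ := by
        rwa [← div_eq_inv_mul, ← add_div, le_div_iff₀ hlθ]
      have h5 : (Real.log θ⁻¹)⁻¹ * Real.log τ⁻¹ ≤
          (2 + Real.log K + (Real.log θ⁻¹)⁻¹) * Real.log τ⁻¹ := by
        gcongr
        linarith
      rw [List.length_append, List.length_singleton]
      push_cast
      linarith

theorem Zset_finite {τ : ℝ} (hτ : 0 < τ) (hτ1 : τ < 1) : (S.Zset τ).Finite := by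
  obtain ⟨D, κ, -, -, h⟩ := S.exists_length_bounds
  refine (List.finite_length_le _ (⌊D * Real.log τ⁻¹ + κ⌋₊ + 1)).subset fun z hz => ?_
  rcases List.eq_nil_or_concat' z with rfl | ⟨w, b, rfl⟩
  · exact absurd rfl hz.2.1
  · have := Nat.le_floor (h τ hτ hτ1 w b hz).2
    simpa using this

theorem exists_wordSq_concat_le : ∃ C : ℝ, 1 ≤ C ∧ ∀ τ : ℝ, 0 < τ → τ < 1 → ∀ z ∈ S.Zset τ,
    ∀ h, IsWord (z ++ [h]) → S.wordSq (z ++ [h]) ≤ C / τ := by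
  obtain ⟨K, hK, -, hKw⟩ := S.exists_wordSq_append_le
  obtain ⟨k₁, k₂, -, hk₂, hkb⟩ := S.exists_ups_bounds
  have hK0 : 0 < K := by linarith
  refine ⟨K ^ 3 * max k₂ 1, one_le_mul_of_one_le_of_one_le (one_le_pow₀ hK) (le_max_right _ _),
    fun τ hτ hτ1 z hz h hzh => ?_⟩
  obtain ⟨hzw, hz0, -, hlt⟩ := hz
  rcases List.eq_nil_or_concat' z with rfl | ⟨w, b, rfl⟩
  · exact absurd rfl hz0
  rw [List.dropLast_concat] at hlt
  have hww := (isWord_append.1 hzw).1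
  have h1 : S.wordSq (w ++ [b] ++ [h]) ≤ K * (K * S.wordSq w) :=
    (hKw _ h hzh).trans (mul_le_mul_of_nonneg_left (hKw w b hzw) hK0.le)
  have h2 : S.wordSq w ≤ K * (max k₂ 1 / τ) := by
    rcases List.eq_nil_or_concat' w with rfl | ⟨v, e, rfl⟩
    · rw [wordSq_nil]
      refine one_le_mul_of_one_le_of_one_le hK ((one_le_div hτ).2 ?_)
      exact hτ1.le.trans (le_max_right _ _)
    · refine (hKw v e hww).trans (mul_le_mul_of_nonneg_left ?_ hK0.le)
      have hv := S.wordSq_pos (isWord_append.1 hww).1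
      have h3 := (hlt.trans_le (hkb v e hww).2).le
      rw [le_div_iff₀ hv] at h3
      rw [le_div_iff₀ hτ]
      linarith [le_max_left k₂ 1]
  calc _ ≤ K * (K * (K * (max k₂ 1 / τ))) := h1.trans (by gcongr)
    _ = _ := by ring

theorem ups_append_le {w : List (Fin (2 * S.r))} (hw : w ≠ []) {v : List (Fin (2 * S.r))}
    (h : IsWord (w ++ v)) : S.ups (w ++ v) ≤ S.ups w := by
  obtain ⟨θ, hθ, hθ1, hθc⟩ := S.exists_contraction
  induction v using List.reverseRecOn with
  | nil => simp
  | append_singleton v b ih =>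
    rw [← List.append_assoc] at h ⊢
    have h' := (isWord_append.1 h).1
    refine le_trans ?_ (ih h')
    rcases List.eq_nil_or_concat' (w ++ v) with h0 | ⟨u, e, hu⟩
    · simp [hw] at h0
    · rw [hu] at h h' ⊢
      have := S.ups_pos h'
      exact (hθc u e b h).trans (mul_le_of_le_one_left this.le hθ1.le)

theorem eq_of_prefix {τ : ℝ} {z z' : List (Fin (2 * S.r))} (hz : z ∈ S.Zset τ)
    (hz' : z' ∈ S.Zset τ) (h : z <+: z') : z = z' := by
  obtain ⟨v, rfl⟩ := h
  rcases List.eq_nil_or_concat' v with rfl | ⟨u, e, rfl⟩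
  · simp
  · have h1 := hz'.2.2.2
    have h2 := hz'.1
    rw [← List.append_assoc] at h1 h2
    rw [List.dropLast_concat] at h1
    linarith [hz.2.2.1, S.ups_append_le hz.2.1 (isWord_append.1 h2).1]

theorem mobiusR_wprod_cons {a b : Fin (2 * S.r)} {w : List (Fin (2 * S.r))}
    (h : IsWord (a :: w ++ [b])) {x : ℝ} (hx : x ∈ S.Jreal b) :
    mobiusR (S.wprod (a :: w)) x = mobiusR (S.g a) (mobiusR (S.wprod w) x) ∧
    mobiusDen (S.g a) (mobiusR (S.wprod w) x) ≠ 0 ∧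
    mobiusR (S.wprod (a :: w)) x ∈ S.Ireal a := by
  obtain ⟨h1, -, h2⟩ := isWord_append.1 h
  obtain ⟨h3, -, h4⟩ := isWord_append.1 (isWord_cons.1 (show IsWord (a :: (w ++ [b])) from h)).2
  obtain ⟨h5, h6⟩ := S.wprod_mem_Ireal h1 h2 hx
  have h7 := (S.wprod_mem_Ireal h3 h4 hx).1
  refine ⟨by rw [wprod_cons, mobiusR_mul _ _ h7], ?_, h6 a rfl⟩
  rw [wprod_cons, mobiusDen_mul _ _ h7] at h5
  exact left_ne_zero_of_mul h5

theorem mobiusR_wprod_ne {w v : List (Fin (2 * S.r))} {b c : Fin (2 * S.r)}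
    (hw : IsWord (w ++ [b])) (hv : IsWord (v ++ [c])) (hwv : ¬ w <+: v) (hvw : ¬ v <+: w)
    {x y : ℝ} (hx : x ∈ S.Jreal b) (hy : y ∈ S.Jreal c) :
    mobiusR (S.wprod w) x ≠ mobiusR (S.wprod v) y := by
  induction w generalizing v with
  | nil => exact absurd (List.nil_prefix) hwv
  | cons a w ih =>
    rcases v with _ | ⟨a', v⟩
    · exact absurd (List.nil_prefix) hvw
    · intro h
      obtain ⟨h1, h2, h3⟩ := S.mobiusR_wprod_cons hw hx
      obtain ⟨h1', h2', h3'⟩ := S.mobiusR_wprod_cons hv hy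
      rw [h] at h3
      obtain rfl := S.eq_of_mem_Jreal (S.Ireal_subset_Jreal _ h3) (S.Ireal_subset_Jreal _ h3')
      rw [List.prefix_cons_inj] at hwv hvw
      rw [h1, h1'] at h
      exact ih (isWord_cons.1 (show IsWord (a :: (w ++ [b])) from hw)).2
        (isWord_cons.1 (show IsWord (a :: (v ++ [c])) from hv)).2 hwv hvw
        (mobiusR_injOn _ h2 h2' h)

theorem TS_ofReal {a : Fin (2 * S.r)} {x : ℝ} (hx : x ∈ S.Ireal a)
    (h0 : mobiusDen (S.g a)⁻¹ x ≠ 0) :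
    S.TS ((x : ℂ) : OnePoint ℂ) = ((mobiusR (S.g a)⁻¹ x : ℂ) : OnePoint ℂ) := by
  have hex : ∃ a : Fin (2 * S.r), ∃ w : ℂ, ((x : ℂ) : OnePoint ℂ) = (w : OnePoint ℂ) ∧
    w ∈ S.D a := ⟨a, x, rfl, hx⟩
  have hch : hex.choose = a := by
    obtain ⟨w, hw, hwD⟩ := hex.choose_spec
    obtain rfl := OnePoint.coe_injective hw
    exact S.eq_of_mem_Jreal (S.Ireal_subset_Jreal _ hwD) (S.Ireal_subset_Jreal _ hx)
  rw [TS, dif_pos hex, hch, mobiusS_ofReal _ h0]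

theorem TS_iterate_mem {w : List (Fin (2 * S.r))} {b : Fin (2 * S.r)} (hw : IsWord (w ++ [b]))
    {y : ℝ} (hy : y ∈ S.Jreal b) {n : ℕ} (hn : n < w.length) :
    ∃ z : ℂ, S.TS^[n] ((mobiusR (S.wprod w) y : ℂ) : OnePoint ℂ) = (z : OnePoint ℂ) ∧
      z ∈ S.Dall := by
  induction n generalizing w with
  | zero =>
    obtain ⟨a, v, rfl⟩ := List.exists_cons_of_ne_nil (List.ne_nil_of_length_pos hn)
    exact ⟨_, rfl, Set.mem_iUnion.2 ⟨a, (S.mobiusR_wprod_cons hw hy).2.2⟩⟩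
  | succ n ih =>
    obtain ⟨a, v, rfl⟩ := List.exists_cons_of_ne_nil
      (List.ne_nil_of_length_pos (Nat.zero_lt_of_lt hn))
    obtain ⟨h1, h2, h3⟩ := S.mobiusR_wprod_cons hw hy
    rw [Function.iterate_succ_apply, S.TS_ofReal h3 (by rw [h1]; exact mobiusDen_inv_mobiusR _ h2),
      h1, mobiusR_inv_mobiusR _ h2]
    exact ih (isWord_cons.1 (show IsWord (a :: (v ++ [b])) from hw)).2 (by simpa using hn)

theorem dimH_limitSetR_le : dimH S.limitSetR ≤ dimH S.limitSet := by
  rw [← Complex.isometry_ofReal.dimH_image]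
  exact dimH_mono (Set.image_subset_iff.2 fun x hx => hx)

theorem dimH_limitSet_ne_top : dimH S.limitSet ≠ ⊤ := by
  refine ne_top_of_le_ne_top ?_ (dimH_mono (Set.subset_univ S.limitSet))
  rw [Real.dimH_univ_eq_finrank]
  exact ENNReal.natCast_ne_top _

end Schottky

namespace Schottky

variable (S : Schottky)

theorem ofReal_le_dimH_limitSetR {K : ℝ}
    (hKw : ∀ w v, IsWord (w ++ v) → S.wordSq (w ++ v) ≤ K * (S.wordSq w * S.wordSq v))
    {f : Fin (2 * S.r)} {m : ℕ} (hm : 1 < m) {T : ℝ} (hT : 1 < T)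
    (ω : Fin m → List (Fin (2 * S.r))) (hω : ∀ i, IsWord (ω i ++ [f]))
    (hhead : ∀ i, (ω i).head? = some f) (hsq : ∀ i, K * S.wordSq (ω i) ≤ T)
    (hpre : ∀ i j, ω i <+: ω j → i = j) :
    ENNReal.ofReal (Real.log m / Real.log T) ≤ dimH S.limitSetR := by
  obtain ⟨k₁, k₂, hk₁, -, hk⟩ := S.exists_distortion
  have hT0 : 0 < T := one_pos.trans hT
  set φ : Fin m → ℝ → ℝ := fun i => mobiusR (S.wprod (ω i)) with hφ
  have hmaps : ∀ i, Set.MapsTo (φ i) (S.Jreal f) (S.Jreal f) := fun i x hx =>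
    S.Ireal_subset_Jreal _ ((S.wprod_mem_Ireal (isWord_append.1 (hω i)).1
      (isWord_append.1 (hω i)).2.2 hx).2 f (hhead i))
  have hfold : ∀ w : List (Fin m), IsWord (w.flatMap ω ++ [f]) ∧ w.length ≤ (w.flatMap ω).length ∧
      S.wordSq (w.flatMap ω) ≤ T ^ w.length ∧ ∀ x ∈ S.Jreal f,
        w.foldr (fun i => φ i) x ∈ S.Jreal f ∧
        w.foldr (fun i => φ i) x = mobiusR (S.wprod (w.flatMap ω)) x := by
    intro w
    induction w with
    | nil =>
      refine ⟨isWord_singleton f, le_rfl, ?_, fun x hx => ⟨hx, ?_⟩⟩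
      · simp [wordSq_nil]
      · simp [wprod_nil, mobiusR_one]
    | cons i w ih =>
      obtain ⟨h1, h2, h3, h4⟩ := ih
      have hne : ω i ≠ [] := by
        intro h
        simpa [h] using hhead i
      have hhd : (w.flatMap ω ++ [f]).head? = some f := by
        rcases w with _ | ⟨j, w⟩
        · rfl
        · rw [List.flatMap_cons, List.append_assoc, List.head?_append, hhead j]
          rfl
      have hword : IsWord (ω i ++ (w.flatMap ω ++ [f])) := by
        refine isWord_append.2 ⟨(isWord_append.1 (hω i)).1, h1, ?_⟩
        rw [arrow, hhd]
        exact (isWord_append.1 (hω i)).2.2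
      rw [← List.append_assoc] at hword
      rw [List.flatMap_cons]
      refine ⟨hword, ?_, ?_, fun x hx => ?_⟩
      · rw [List.length_append, List.length_cons]
        have := List.length_pos_iff.2 hne
        omega
      · have hpos := S.wordSq_pos (isWord_append.1 h1).1
        rw [List.length_cons, pow_succ']
        calc _ ≤ K * (S.wordSq (ω i) * S.wordSq (w.flatMap ω)) :=
              hKw _ _ (isWord_append.1 hword).1
          _ = K * S.wordSq (ω i) * S.wordSq (w.flatMap ω) := by ring
          _ ≤ _ := mul_le_mul (hsq i) h3 hpos.le hT0.le
      · obtain ⟨h5, h6⟩ := h4 x hx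
        refine ⟨hmaps i h5, ?_⟩
        rw [List.foldr_cons, h6, wprod_append, mobiusR_mul]
        exact (S.wprod_mem_Ireal (isWord_append.1 h1).1 (isWord_append.1 h1).2.2 hx).1
  rw [← inv_inv T]
  refine le_dimH_of_ifs hm (inv_pos.2 hT0) (inv_lt_one_of_one_lt₀ hT) hk₁
    (isCompact_Icc : IsCompact (S.Jreal f)) ⟨_, S.lo_mem f⟩ φ hmaps
    (fun i => S.continuousOn_mobiusR_wprod (hω i)) ?_ ?_ ?_
  · intro i j hij
    rw [Set.disjoint_left]
    rintro _ ⟨x, hx, rfl⟩ ⟨y, hy, hxy⟩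
    exact S.mobiusR_wprod_ne (hω j) (hω i) (fun h => hij (hpre _ _ h).symm)
      (fun h => hij (hpre _ _ h)) hy hx hxy
  · intro w x hx y hy
    obtain ⟨h1, -, h3, h4⟩ := hfold w
    have hpos := S.wordSq_pos (isWord_append.1 h1).1
    have key : ∀ x ∈ S.Jreal f, ∀ y ∈ S.Jreal f, x ≤ y → k₁ * T⁻¹ ^ w.length * |x - y| ≤
        |w.foldr (fun i => φ i) x - w.foldr (fun i => φ i) y| := by
      intro x hx y hy hxy
      rw [(h4 x hx).2, (h4 y hy).2, abs_sub_comm, abs_sub_comm _ (mobiusR _ y),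
        abs_of_nonneg (sub_nonneg.2 hxy)]
      refine le_trans ?_ ((hk _ f h1 x hx y hy hxy).1.trans (le_abs_self _))
      rw [inv_pow, mul_right_comm, ← div_eq_mul_inv]
      have := sub_nonneg.2 hxy
      gcongr
    rcases le_total x y with hxy | hxy
    · exact key x hx y hy hxy
    · rw [abs_sub_comm, abs_sub_comm (List.foldr _ x w)]
      exact key y hy x hx hxy
  · intro x hx n
    obtain ⟨w, hw, y, hy, rfl⟩ := hx (n + 1)
    obtain ⟨h1, h2, -, h4⟩ := hfold w
    simp only [(h4 y hy).2]
    exact S.TS_iterate_mem h1 hy (by omega)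

theorem delta_nonneg : 0 ≤ S.delta := ENNReal.toReal_nonneg

theorem natCast_le_rpow_delta {K : ℝ}
    (hKw : ∀ w v, IsWord (w ++ v) → S.wordSq (w ++ v) ≤ K * (S.wordSq w * S.wordSq v))
    {f : Fin (2 * S.r)} {m : ℕ} {T : ℝ} (hT : 1 < T)
    (ω : Fin m → List (Fin (2 * S.r))) (hω : ∀ i, IsWord (ω i ++ [f]))
    (hhead : ∀ i, (ω i).head? = some f) (hsq : ∀ i, K * S.wordSq (ω i) ≤ T)
    (hpre : ∀ i j, ω i <+: ω j → i = j) : (m : ℝ) ≤ T ^ S.delta := by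
  rcases le_or_gt m 1 with hm | hm
  · calc (m : ℝ) ≤ 1 := by exact_mod_cast hm
      _ ≤ _ := Real.one_le_rpow hT.le S.delta_nonneg
  have h := (S.ofReal_le_dimH_limitSetR hKw hm hT ω hω hhead hsq hpre).trans
    S.dimH_limitSetR_le
  rw [ENNReal.ofReal_le_iff_le_toReal S.dimH_limitSet_ne_top, div_le_iff₀ (Real.log_pos hT)] at h
  rw [Real.rpow_def_of_pos (one_pos.trans hT), ← Real.log_le_iff_le_exp (by positivity), mul_comm]
  exact h

theorem exists_connecting_letter (e f : Fin (2 * S.r)) :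
    ∃ h : Fin (2 * S.r), e ≠ wordBar h ∧ h ≠ wordBar f := by
  have hcard : ({wordBar e, wordBar f} : Finset (Fin (2 * S.r))).card <
      (Finset.univ : Finset (Fin (2 * S.r))).card := by
    rw [Finset.card_univ, Fintype.card_fin]
    have := S.two_le_r
    exact Finset.card_le_two.trans_lt (by omega)
  obtain ⟨h, -, hh⟩ := Finset.exists_mem_notMem_of_card_lt_card hcard
  simp only [Finset.mem_insert, Finset.mem_singleton, not_or] at hh
  exact ⟨h, fun h' => hh.1 (wordBar_eq_comm.1 h'.symm), hh.2⟩

theorem exists_ncard_Zset_le : ∃ C : ℝ, 0 < C ∧ ∀ τ : ℝ, 0 < τ → τ < 1 →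
    ((S.Zset τ).ncard : ℝ) ≤ C * τ ^ (-S.delta) := by
  obtain ⟨K, hK, hKw, -⟩ := S.exists_wordSq_append_le
  obtain ⟨C, hC, hCw⟩ := S.exists_wordSq_concat_le
  have hr := S.r_pos
  have hKC : 1 ≤ K * C := one_le_mul_of_one_le_of_one_le hK hC
  refine ⟨(2 * S.r) ^ 2 * (K * C) ^ S.delta, by positivity, fun τ hτ hτ1 => ?_⟩
  have hfin := S.Zset_finite hτ hτ1
  set Z : Fin (2 * S.r) × Fin (2 * S.r) → Set (List (Fin (2 * S.r))) := fun q =>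
    {z ∈ S.Zset τ | z.head? = some q.1 ∧ z.getLast? = some q.2} with hZ
  have hZfin : ∀ q, (Z q).Finite := fun q => hfin.subset fun z hz => hz.1
  have hT : 1 < K * C / τ := (one_lt_div hτ).2 (hτ1.trans_le hKC)
  have hcount : ∀ q, ((Z q).ncard : ℝ) ≤ (K * C / τ) ^ S.delta := by
    rintro ⟨f, e⟩
    obtain ⟨h, heh, hhf⟩ := S.exists_connecting_letter e f
    have : Finite (Z (f, e)) := hZfin _
    let E : Fin (Z (f, e)).ncard ≃ Z (f, e) := (Finite.equivFin _).symm
    have hz : ∀ i, IsWord ((E i : List (Fin (2 * S.r))) ++ [h]) := fun i =>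
      isWord_append.2 ⟨(E i).2.1.1, isWord_singleton h, by
        rw [arrow_singleton_right, (E i).2.2.2]
        simpa using heh⟩
    refine S.natCast_le_rpow_delta hKw (f := f) hT (fun i => (E i : List (Fin (2 * S.r))) ++ [h])
      (fun i => ?_) (fun i => ?_) (fun i => ?_) (fun i j hij => ?_)
    · refine isWord_append.2 ⟨hz i, isWord_singleton f, ?_⟩
      rw [arrow_concat_left]
      simpa using hhf
    · rw [List.head?_append, (E i).2.2.1]
      rfl
    · rw [mul_div_assoc]
      exact mul_le_mul_of_nonneg_left (hCw τ hτ hτ1 _ (E i).2.1 h (hz i)) (by linarith)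
    · apply E.injective
      apply Subtype.ext
      rcases List.prefix_or_prefix_of_prefix ((List.prefix_append _ _).trans hij)
        (List.prefix_append _ [h]) with h' | h'
      · exact S.eq_of_prefix (E i).2.1 (E j).2.1 h'
      · exact (S.eq_of_prefix (E j).2.1 (E i).2.1 h').symm
  have hsub : S.Zset τ ⊆ ⋃ q, Z q := by
    intro z hz
    have h0 := hz.2.1
    exact Set.mem_iUnion.2 ⟨(z.head h0, z.getLast h0), hz, List.head?_eq_some_head h0,
      List.getLast?_eq_some_getLast h0⟩
  have h1 : (S.Zset τ).ncard ≤ ∑ q, (Z q).ncard :=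
    (Set.ncard_le_ncard hsub (Set.finite_iUnion hZfin)).trans (Set.ncard_iUnion_le_of_fintype Z)
  calc ((S.Zset τ).ncard : ℝ) ≤ ∑ q, ((Z q).ncard : ℝ) := by exact_mod_cast h1
    _ ≤ ∑ _q : Fin (2 * S.r) × Fin (2 * S.r), (K * C / τ) ^ S.delta :=
        Finset.sum_le_sum fun q _ => hcount q
    _ = _ := by
        rw [Finset.sum_const, Finset.card_univ, Fintype.card_prod, Fintype.card_fin, nsmul_eq_mul,
          Real.div_rpow (by positivity) hτ.le, Real.rpow_neg hτ.le]
        push_cast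
        ring

theorem Zbar_finite {τ : ℝ} (hτ : 0 < τ) (hτ1 : τ < 1) : (S.Zbar τ).Finite :=
  ((S.Zset_finite hτ hτ1).preimage mirror_injective.injOn).subset fun _ h => h.2

theorem ncard_Zbar_le {τ : ℝ} (hτ : 0 < τ) (hτ1 : τ < 1) :
    (S.Zbar τ).ncard ≤ (S.Zset τ).ncard :=
  Set.ncard_le_ncard_of_injOn mirror (fun _ h => h.2) mirror_injective.injOn (S.Zset_finite hτ hτ1)

theorem ne_nil_of_mem_Zbar {τ : ℝ} {a : List (Fin (2 * S.r))} (ha : a ∈ S.Zbar τ) : a ≠ [] := by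
  rintro rfl
  exact ha.2.2.1 rfl

theorem ncard_PowerPairsPart_le_of_le {τ : ℝ} (hτ : 0 < τ) (hτ1 : τ < 1) {L M₁ M₂ R q : ℕ}
    (hq : 2 ≤ q) (hM : M₂ ≤ M₁) :
    (S.PowerPairsPart τ L M₁ M₂ R q).ncard ≤ (S.Zbar τ).ncard * (2 * S.r) := by
  have : NeZero (2 * S.r) := ⟨by have := S.r_pos; omega⟩
  have hprod : (S.Zbar τ ×ˢ (Set.univ : Set (Fin (2 * S.r)))).ncard =
      (S.Zbar τ).ncard * (2 * S.r) := by
    rw [Set.ncard_prod, Set.ncard_univ, Nat.card_fin]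
  rw [← hprod]
  refine Set.ncard_le_ncard_of_injOn (fun p => (p.1, p.2.getLastD 0))
    (fun p hp => ⟨hp.1.1, Set.mem_univ _⟩) ?_ ((S.Zbar_finite hτ hτ1).prod Set.finite_univ)
  intro p hp p' hp' h
  obtain ⟨h1, h2⟩ := Prod.ext_iff.1 h
  have h3 := PowerPairsPart.dropLast_snd_eq hq hM hp hp' h1
  have h4 := S.ne_nil_of_mem_Zbar hp.1.2.1
  have h5 := S.ne_nil_of_mem_Zbar hp'.1.2.1
  refine Prod.ext h1 ?_
  rw [← List.dropLast_append_getLast h4, ← List.dropLast_append_getLast h5, h3]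
  congr 2
  simpa [List.getLastD_eq_getLast?, List.getLast?_eq_some_getLast h4,
    List.getLast?_eq_some_getLast h5] using h2

theorem ncard_PowerPairsPart_le {τ : ℝ} (hτ : 0 < τ) (hτ1 : τ < 1) {L M₁ M₂ R q : ℕ}
    (hq : 2 ≤ q) : (S.PowerPairsPart τ L M₁ M₂ R q).ncard ≤ (S.Zbar τ).ncard * (2 * S.r) := by
  rcases le_total M₂ M₁ with hM | hM
  · exact S.ncard_PowerPairsPart_le_of_le hτ hτ1 hq hM
  · refine le_trans ?_ (S.ncard_PowerPairsPart_le_of_le hτ hτ1 hq hM (L := L) (R := R))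
    refine Set.ncard_le_ncard_of_injOn Prod.swap (fun p hp => PowerPairsPart.swap hp)
      Prod.swap_injective.injOn ?_
    refine ((S.Zbar_finite hτ hτ1).prod (S.Zbar_finite hτ hτ1)).subset fun p hp =>
      ⟨hp.1.1, hp.1.2.1⟩

theorem le_length_of_mem_PowerPairsPart {τ : ℝ} {L M₁ M₂ R q : ℕ}
    {p : List (Fin (2 * S.r)) × List (Fin (2 * S.r))} (hp : p ∈ S.PowerPairsPart τ L M₁ M₂ R q) :
    q ≤ (L + M₁ + R) + (L + M₂ + R) := by
  have hne := PowerPairsQ.ne_one hp.1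
  obtain ⟨⟨-, -, ⟨γ, hγ, hγq⟩, -⟩, h5, h6, -⟩ := hp
  rw [hγq] at hne
  have := S.le_length_of_pow_eq hγ hne (l := p.1.dropLast ++ mirror p.2.dropLast)
    (by rw [wprod_append, wprod_mirror, hγq])
  rwa [List.length_append, length_mirror, h5, h6] at this

theorem exists_length_bounds_Zbar : ∃ D κ : ℝ, 1 < D ∧ 0 < κ ∧ ∀ τ : ℝ, 0 < τ → τ < 1 →
    ∀ a ∈ S.Zbar τ, D⁻¹ * Real.log τ⁻¹ - κ ≤ a.dropLast.length ∧
      a.dropLast.length ≤ D * Real.log τ⁻¹ + κ := by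
  obtain ⟨D, κ, hD, hκ, h⟩ := S.exists_length_bounds
  refine ⟨D, κ, hD, hκ, fun τ hτ hτ1 a ha => ?_⟩
  rcases List.eq_nil_or_concat' (mirror a) with h0 | ⟨w, b, hw⟩
  · exact absurd h0 ha.2.2.1
  · have hlen : a.dropLast.length = w.length := by
      rw [List.length_dropLast, ← length_mirror, hw]
      simp
    rw [hlen]
    exact h τ hτ hτ1 w b (hw ▸ ha.2)

end Schottky

/-- (i) `PowerPairs(τ, L, M₁, M₂, R; q)` is empty unless
`N₁, N₂, q` are comparable to `log(1/τ)`; (ii) under those bounds on `N₁, N₂` its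
cardinality is at most `K τ^{-δ}`. -/
theorem stmt_10 (S : Schottky) :
    ∃ D κ K : ℝ, 1 < D ∧ 0 < κ ∧ 0 < K ∧
      ∀ τ : ℝ, 0 < τ → τ < 1 →
        ∀ L M₁ M₂ R q : ℕ, 2 ≤ q →
          ((¬ (D⁻¹ * Real.log τ⁻¹ - κ ≤ ((L + M₁ + R : ℕ) : ℝ) ∧
               ((L + M₁ + R : ℕ) : ℝ) ≤ D * Real.log τ⁻¹ + κ ∧
               D⁻¹ * Real.log τ⁻¹ - κ ≤ ((L + M₂ + R : ℕ) : ℝ) ∧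
               ((L + M₂ + R : ℕ) : ℝ) ≤ D * Real.log τ⁻¹ + κ ∧
               (q : ℝ) ≤ D * Real.log τ⁻¹ + κ) →
            S.PowerPairsPart τ L M₁ M₂ R q = ∅) ∧
           ((D⁻¹ * Real.log τ⁻¹ - κ ≤ ((L + M₁ + R : ℕ) : ℝ) ∧
               ((L + M₁ + R : ℕ) : ℝ) ≤ D * Real.log τ⁻¹ + κ ∧
               D⁻¹ * Real.log τ⁻¹ - κ ≤ ((L + M₂ + R : ℕ) : ℝ) ∧
               ((L + M₂ + R : ℕ) : ℝ) ≤ D * Real.log τ⁻¹ + κ) →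
            ((S.PowerPairsPart τ L M₁ M₂ R q).ncard : ℝ) ≤ K * τ ^ (-S.delta))) := by
  obtain ⟨D, κ, hD, hκ, hlen⟩ := S.exists_length_bounds_Zbar
  obtain ⟨C, hC, hcard⟩ := S.exists_ncard_Zset_le
  have hr := S.r_pos
  refine ⟨2 * D, 2 * κ, C * (2 * S.r), by linarith, by positivity, by positivity,
    fun τ hτ hτ1 L M₁ M₂ R q hq => ⟨fun hN => ?_, fun _ => ?_⟩⟩
  · by_contra hne
    obtain ⟨p, hp⟩ := Set.nonempty_iff_ne_empty.2 hne
    apply hN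
    have hlτ : 0 < Real.log τ⁻¹ := Real.log_pos ((one_lt_inv₀ hτ).2 hτ1)
    obtain ⟨h1, h2⟩ := hlen τ hτ hτ1 _ hp.1.1
    obtain ⟨h3, h4⟩ := hlen τ hτ hτ1 _ hp.1.2.1
    rw [hp.2.1] at h1 h2
    rw [hp.2.2.1] at h3 h4
    have h5 : (q : ℝ) ≤ ((L + M₁ + R : ℕ) : ℝ) + ((L + M₂ + R : ℕ) : ℝ) := by
      exact_mod_cast S.le_length_of_mem_PowerPairsPart hp
    have h6 : (2 * D)⁻¹ * Real.log τ⁻¹ ≤ D⁻¹ * Real.log τ⁻¹ := by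
      gcongr
      linarith
    have h7 : 0 < D * Real.log τ⁻¹ := by positivity
    refine ⟨?_, ?_, ?_, ?_, ?_⟩ <;> linarith
  · calc ((S.PowerPairsPart τ L M₁ M₂ R q).ncard : ℝ) ≤ (S.Zset τ).ncard * (2 * S.r) := by
          exact_mod_cast (S.ncard_PowerPairsPart_le hτ hτ1 hq).trans
            (Nat.mul_le_mul_right _ (S.ncard_Zbar_le hτ hτ1))
      _ ≤ C * τ ^ (-S.delta) * (2 * S.r) := by
          gcongr
          exact hcard τ hτ hτ1
      _ = _ := by ring
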